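/- Let Ω, K ⊂ ℝⁿ be convex bodies with nonempty interior, r = r(Ω,K), p(λ) := Per_K(Ω ∼ λK), and v(λ) := V_n(Ω ∼ λK). Then the right derivative p′₊(λ) exists for every λ ∈ [0, r), and the function ξ(λ) := p(λ)² + (n/(n−1))·v(λ)·p′₊(λ) is non-negative on [0, r). -/

import Mathlib

open Pointwise MeasureTheory Set

noncomputable section

/-- The inner parallel body `Ω ∼ λK = {x : x + λK ⊆ Ω}`. -/
def innerPar {n : ℕ} (Ω K : Set (EuclideanSpace ℝ (Fin n))) (l : ℝ) :
    Set (EuclideanSpace ℝ (Fin n)) :=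
  {x | ∀ y ∈ K, x + l • y ∈ Ω}

/-- The inradius of `Ω` relative to `K`. -/
def inrad {n : ℕ} (Ω K : Set (EuclideanSpace ℝ (Fin n))) : ℝ :=
  sSup {l : ℝ | 0 ≤ l ∧ ∃ x, ∀ y ∈ K, x + l • y ∈ Ω}

/-- The anisotropic perimeter of `C` relative to `K`, realized as the anisotropic
Minkowski content `d/dt V_n(C + tK) |_{t=0⁺}`. -/
def aniPer {n : ℕ} (C K : Set (EuclideanSpace ℝ (Fin n))) : ℝ :=
  derivWithin (fun t : ℝ => (volume (C + t • K)).toReal) (Set.Ici (0:ℝ)) 0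

/-- The mixed volume `V(C,…,C,K,…,K)` with `i` copies of `K`, extracted as the
`i`-th Taylor coefficient (over `binom n i`) of `t ↦ V_n(C + tK)` at `t = 0⁺`. -/
def mixedVol {n : ℕ} (i : ℕ) (C K : Set (EuclideanSpace ℝ (Fin n))) : ℝ :=
  iteratedDerivWithin i (fun t : ℝ => (volume (C + t • K)).toReal) (Set.Ici (0:ℝ)) 0
    / (n.choose i * i.factorial)

theorem volume_add_le_of_isCompact {A B C : Set ℝ} (hA : IsCompact A) (hB : IsCompact B)
    (hA0 : A.Nonempty) (hB0 : B.Nonempty) (h : A + B ⊆ C) :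
    volume A + volume B ≤ volume C := by
  obtain ⟨a, ha, hamax⟩ := hA.exists_isMaxOn hA0 continuousOn_id
  obtain ⟨b, hb, hbmin⟩ := hB.exists_isMinOn hB0 continuousOn_id
  have e1 : volume (b +ᵥ A) = volume A := measure_vadd volume b A
  have e2 : volume (a +ᵥ B) = volume B := measure_vadd volume a B
  have hinter : (b +ᵥ A) ∩ (a +ᵥ B) ⊆ {a + b} := by
    rintro _ ⟨⟨x, hx, rfl⟩, ⟨y, hy, hxy⟩⟩
    have h1 : x ≤ a := hamax hx
    have h2 : b ≤ y := hbmin hy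
    simp only [vadd_eq_add, mem_singleton_iff] at hxy ⊢
    linarith
  have hae : AEDisjoint volume (b +ᵥ A) (a +ᵥ B) := measure_mono_null hinter (by simp)
  rw [← e1, ← e2, ← measure_union₀ (hB.vadd a).measurableSet.nullMeasurableSet hae]
  refine measure_mono (union_subset ?_ ?_)
  · rintro _ ⟨x, hx, rfl⟩
    exact h ⟨x, hx, b, hb, add_comm _ _⟩
  · rintro _ ⟨x, hx, rfl⟩
    exact h ⟨a, ha, x, hx, rfl⟩

theorem volume_add_le_of_measurableSet {A B C : Set ℝ} (hA : MeasurableSet A)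
    (hB : MeasurableSet B) (hA0 : A.Nonempty) (hB0 : B.Nonempty) (h : A + B ⊆ C) :
    volume A + volume B ≤ volume C := by
  obtain ⟨a, ha⟩ := hA0
  obtain ⟨b, hb⟩ := hB0
  have key : ∀ K ⊆ A, IsCompact K → ∀ L ⊆ B, IsCompact L → volume K + volume L ≤ volume C := by
    intro K hKA hK L hLB hL
    refine le_trans (add_le_add (measure_mono (subset_insert a K))
      (measure_mono (subset_insert b L))) ?_
    refine volume_add_le_of_isCompact (hK.insert a) (hL.insert b) (insert_nonempty _ _)
      (insert_nonempty _ _) (subset_trans (add_subset_add ?_ ?_) h)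
    · exact insert_subset ha hKA
    · exact insert_subset hb hLB
  have key2 : ∀ L ⊆ B, IsCompact L → volume A + volume L ≤ volume C := by
    intro L hLB hL
    have hLC : volume L ≤ volume C := by
      simpa using key ∅ (empty_subset _) isCompact_empty L hLB hL
    refine add_le_of_le_tsub_right_of_le hLC ?_
    rw [hA.measure_eq_iSup_isCompact]
    refine iSup₂_le fun K hKA => iSup_le fun hK => ?_
    exact ENNReal.le_sub_of_add_le_right hL.measure_ne_top (key K hKA hK L hLB hL)
  have hAC : volume A ≤ volume C := by
    simpa using key2 ∅ (empty_subset _) isCompact_empty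
  by_cases hAt : volume A = ⊤
  · rw [hAt, top_le_iff] at hAC
    simp [hAC]
  refine add_le_of_le_tsub_left_of_le hAC ?_
  rw [hB.measure_eq_iSup_isCompact]
  refine iSup₂_le fun L hLB => iSup_le fun hL => ?_
  exact ENNReal.le_sub_of_add_le_left hAt (key2 L hLB hL)

/-- A weighted sum of the integrals of two functions with essential supremum one is at most the
integral of any function dominating their weighted geometric means. -/
theorem lintegral_add_le_of_sup_eq_one {f g h : ℝ → ℝ} {t : ℝ} (ht : t ∈ Ioo (0 : ℝ) 1)
    (hf : Measurable f) (hg : Measurable g) (hh : Measurable h)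
    (hf0 : ∀ x, 0 ≤ f x) (hg0 : ∀ x, 0 ≤ g x) (hh0 : ∀ x, 0 ≤ h x)
    (hf1 : ∀ x, f x ≤ 1) (hg1 : ∀ x, g x ≤ 1)
    (hfs : ∀ s < 1, ∃ x, s < f x) (hgs : ∀ s < 1, ∃ x, s < g x)
    (H : ∀ x y, f x ^ (1 - t) * g y ^ t ≤ h ((1 - t) * x + t * y)) :
    ENNReal.ofReal (1 - t) * (∫⁻ x, ENNReal.ofReal (f x)) +
      ENNReal.ofReal t * (∫⁻ x, ENNReal.ofReal (g x)) ≤ ∫⁻ x, ENNReal.ofReal (h x) := by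
  have ht0 : 0 < t := ht.1
  have ht1 : 0 < 1 - t := sub_pos.2 ht.2
  rw [lintegral_eq_lintegral_meas_lt volume (Filter.Eventually.of_forall hf0) hf.aemeasurable,
    lintegral_eq_lintegral_meas_lt volume (Filter.Eventually.of_forall hg0) hg.aemeasurable,
    lintegral_eq_lintegral_meas_lt volume (Filter.Eventually.of_forall hh0) hh.aemeasurable]
  have mf : Measurable fun s : ℝ => volume {x | s < f x} := by
    refine Antitone.measurable fun a b hab => measure_mono fun x hx => ?_
    exact lt_of_le_of_lt hab hx
  have mg : Measurable fun s : ℝ => volume {x | s < g x} := by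
    refine Antitone.measurable fun a b hab => measure_mono fun x hx => ?_
    exact lt_of_le_of_lt hab hx
  rw [← lintegral_const_mul _ mf, ← lintegral_const_mul _ mg,
    ← lintegral_add_left (mf.const_mul _)]
  refine setLIntegral_mono' measurableSet_Ioi fun s hs => ?_
  have hs0 : 0 < s := hs
  by_cases hs1 : s < 1
  · have e1 : ENNReal.ofReal (1 - t) * volume {x | s < f x} = volume ((1 - t) • {x | s < f x}) := by
      rw [Measure.addHaar_smul]; simp [abs_of_pos ht1]
    have e2 : ENNReal.ofReal t * volume {x | s < g x} = volume (t • {x | s < g x}) := by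
      rw [Measure.addHaar_smul]; simp [abs_of_pos ht0]
    rw [e1, e2]
    refine volume_add_le_of_measurableSet
      ((measurableSet_lt measurable_const hf).const_smul_of_ne_zero ht1.ne')
      ((measurableSet_lt measurable_const hg).const_smul_of_ne_zero ht0.ne') ?_ ?_ ?_
    · have hne : Set.Nonempty {x | s < f x} := hfs s hs1
      exact hne.smul_set
    · have hne : Set.Nonempty {x | s < g x} := hgs s hs1
      exact hne.smul_set
    · rintro _ ⟨_, ⟨x, hx, rfl⟩, _, ⟨y, hy, rfl⟩, rfl⟩
      simp only [mem_ofPred_eq, smul_eq_mul] at hx hy ⊢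
      refine lt_of_lt_of_le ?_ (H x y)
      calc s = s ^ (1 - t) * s ^ t := by rw [← Real.rpow_add hs0]; simp
        _ < f x ^ (1 - t) * g y ^ t :=
          mul_lt_mul'' (Real.rpow_lt_rpow hs0.le hx ht1) (Real.rpow_lt_rpow hs0.le hy ht0)
            (by positivity) (by positivity)
  · have e1 : {x | s < f x} = ∅ := by
      ext x; simp; linarith [hf1 x]
    have e2 : {x | s < g x} = ∅ := by
      ext x; simp; linarith [hg1 x]
    simp [e1, e2]

theorem ENNReal.weighted_geom_mean_le {t : ℝ} (ht : t ∈ Ioo (0 : ℝ) 1) (a b : ENNReal) :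
    a ^ (1 - t) * b ^ t ≤ ENNReal.ofReal (1 - t) * a + ENNReal.ofReal t * b := by
  have ht0 : 0 < t := ht.1
  have ht1 : 0 < 1 - t := sub_pos.2 ht.2
  by_cases ha : a = ⊤
  · simp [ha, ENNReal.mul_top, ht.2]
  by_cases hb : b = ⊤
  · simp [hb, ENNReal.mul_top, ht0]
  lift a to NNReal using ha
  lift b to NNReal using hb
  have := NNReal.geom_mean_le_arith_mean2_weighted ⟨1 - t, ht1.le⟩ ⟨t, ht0.le⟩ a b
    (NNReal.eq (show (1 - t) + t = 1 by ring))
  change a ^ (1 - t) * b ^ t ≤ _ at this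
  rw [← ENNReal.coe_rpow_of_nonneg _ ht1.le, ← ENNReal.coe_rpow_of_nonneg _ ht0.le,
    ENNReal.ofReal_eq_coe_nnreal ht1.le, ENNReal.ofReal_eq_coe_nnreal ht0.le]
  exact_mod_cast this

/-- A measure satisfies the Prékopa–Leindler inequality with parameter `t`. -/
def PrekopaLeindler {V : Type*} [AddCommGroup V] [Module ℝ V] [MeasurableSpace V]
    (μ : Measure V) (t : ℝ) : Prop :=
  ∀ f g h : V → ENNReal, Measurable f → Measurable g → Measurable h →
    (∀ x y, f x ^ (1 - t) * g y ^ t ≤ h ((1 - t) • x + t • y)) →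
      (∫⁻ x, f x ∂μ) ^ (1 - t) * (∫⁻ x, g x ∂μ) ^ t ≤ ∫⁻ x, h x ∂μ

theorem lintegral_rpow_mul_le_of_iSup_eq_one {f g h : ℝ → ENNReal} {t : ℝ}
    (ht : t ∈ Ioo (0 : ℝ) 1)
    (hf : Measurable f) (hg : Measurable g) (hh : Measurable h)
    (hf1 : ⨆ x, f x = 1) (hg1 : ⨆ x, g x = 1)
    (H : ∀ x y, f x ^ (1 - t) * g y ^ t ≤ h ((1 - t) • x + t • y)) :
    (∫⁻ x, f x) ^ (1 - t) * (∫⁻ x, g x) ^ t ≤ ∫⁻ x, h x := by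
  have ht0 : 0 < t := ht.1
  have ht1 : 0 < 1 - t := sub_pos.2 ht.2
  have le_f : ∀ x, f x ≤ 1 := fun x => hf1 ▸ le_iSup f x
  have le_g : ∀ x, g x ≤ 1 := fun x => hg1 ▸ le_iSup g x
  have top_f : ∀ x, f x ≠ ⊤ := fun x => ((le_f x).trans_lt ENNReal.one_lt_top).ne
  have top_g : ∀ x, g x ≠ ⊤ := fun x => ((le_g x).trans_lt ENNReal.one_lt_top).ne
  have top_h : ∀ x, min (h x) 1 ≠ ⊤ := fun x =>
    ((min_le_right _ _).trans_lt ENNReal.one_lt_top).ne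
  have sup_toReal : ∀ u : ℝ → ENNReal, ⨆ x, u x = 1 → (∀ x, u x ≠ ⊤) →
      ∀ s < (1 : ℝ), ∃ x, s < (u x).toReal := by
    intro u hu hut s hs
    rcases lt_or_ge s 0 with h0 | h0
    · exact ⟨0, h0.trans_le ENNReal.toReal_nonneg⟩
    · have : ENNReal.ofReal s < ⨆ x, u x := by
        rw [hu]; exact ENNReal.ofReal_lt_one.2 hs
      obtain ⟨x, hx⟩ := lt_iSup_iff.1 this
      exact ⟨x, (ENNReal.ofReal_lt_iff_lt_toReal h0 (hut x)).1 hx⟩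
  have key := lintegral_add_le_of_sup_eq_one ht hf.ennreal_toReal hg.ennreal_toReal
    (hh.min measurable_const : Measurable fun x => min (h x) 1).ennreal_toReal
    (fun _ => ENNReal.toReal_nonneg) (fun _ => ENNReal.toReal_nonneg)
    (fun _ => ENNReal.toReal_nonneg)
    (fun x => ENNReal.toReal_le_of_le_ofReal zero_le_one (by simpa using le_f x))
    (fun x => ENNReal.toReal_le_of_le_ofReal zero_le_one (by simpa using le_g x))
    (sup_toReal f hf1 top_f) (sup_toReal g hg1 top_g) (fun x y => by
      rw [ENNReal.toReal_rpow, ENNReal.toReal_rpow, ← ENNReal.toReal_mul]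
      refine ENNReal.toReal_mono (top_h _) (le_min (H x y) ?_)
      exact mul_le_one' (ENNReal.rpow_le_one (le_f x) ht1.le) (ENNReal.rpow_le_one (le_g y) ht0.le))
  simp only [ENNReal.ofReal_toReal (top_f _), ENNReal.ofReal_toReal (top_g _),
    ENNReal.ofReal_toReal (top_h _)] at key
  exact (ENNReal.weighted_geom_mean_le ht _ _).trans
    (key.trans (lintegral_mono fun x => min_le_left _ _))

theorem lintegral_rpow_mul_le_of_bounded {f g h : ℝ → ENNReal} {t : ℝ} (ht : t ∈ Ioo (0 : ℝ) 1)
    (hf : Measurable f) (hg : Measurable g) (hh : Measurable h)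
    (hfb : ⨆ x, f x ≠ ⊤) (hgb : ⨆ x, g x ≠ ⊤)
    (H : ∀ x y, f x ^ (1 - t) * g y ^ t ≤ h ((1 - t) • x + t • y)) :
    (∫⁻ x, f x) ^ (1 - t) * (∫⁻ x, g x) ^ t ≤ ∫⁻ x, h x := by
  have ht0 : 0 < t := ht.1
  have ht1 : 0 < 1 - t := sub_pos.2 ht.2
  by_cases hf0 : ⨆ x, f x = 0
  · have : ∀ x, f x = 0 := by simpa using hf0
    simp [this, ht1]
  by_cases hg0 : ⨆ x, g x = 0
  · have : ∀ x, g x = 0 := by simpa using hg0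
    simp [this, ht0]
  set a := (⨆ x, f x)⁻¹ with ha
  set b := (⨆ x, g x)⁻¹ with hb
  have ha0 : a ≠ 0 := ENNReal.inv_ne_zero.2 hfb
  have hb0 : b ≠ 0 := ENNReal.inv_ne_zero.2 hgb
  have hat : a ≠ ⊤ := ENNReal.inv_ne_top.2 hf0
  have hbt : b ≠ ⊤ := ENNReal.inv_ne_top.2 hg0
  have hc0 : a ^ (1 - t) * b ^ t ≠ 0 :=
    mul_ne_zero (ENNReal.rpow_pos (pos_iff_ne_zero.2 ha0) hat).ne'
      (ENNReal.rpow_pos (pos_iff_ne_zero.2 hb0) hbt).ne'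
  have hct : a ^ (1 - t) * b ^ t ≠ ⊤ :=
    ENNReal.mul_ne_top (ENNReal.rpow_ne_top_of_nonneg ht1.le hat)
      (ENNReal.rpow_ne_top_of_nonneg ht0.le hbt)
  have expand : ∀ u v : ENNReal, (a * u) ^ (1 - t) * (b * v) ^ t =
      (a ^ (1 - t) * b ^ t) * (u ^ (1 - t) * v ^ t) := by
    intro u v
    rw [ENNReal.mul_rpow_of_nonneg _ _ ht1.le, ENNReal.mul_rpow_of_nonneg _ _ ht0.le,
      mul_mul_mul_comm]
  have key := lintegral_rpow_mul_le_of_iSup_eq_one ht (hf.const_mul a) (hg.const_mul b)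
    (hh.const_mul (a ^ (1 - t) * b ^ t))
    (by rw [← ENNReal.mul_iSup, ha, ENNReal.inv_mul_cancel hf0 hfb])
    (by rw [← ENNReal.mul_iSup, hb, ENNReal.inv_mul_cancel hg0 hgb])
    (fun x y => by rw [expand]; exact mul_le_mul_right (H x y) _)
  rw [lintegral_const_mul _ hf, lintegral_const_mul _ hg, lintegral_const_mul _ hh, expand] at key
  exact (ENNReal.mul_le_mul_iff_right hc0 hct).1 key

theorem prekopaLeindler_real {t : ℝ} (ht : t ∈ Ioo (0 : ℝ) 1) :
    PrekopaLeindler (volume : Measure ℝ) t := by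
  intro f g h hf hg hh H
  have ht0 : 0 < t := ht.1
  have ht1 : 0 < 1 - t := sub_pos.2 ht.2
  by_cases hf0 : ∫⁻ x, f x = 0
  · simp [hf0, ht1]
  by_cases hg0 : ∫⁻ x, g x = 0
  · simp [hg0, ht0]
  have tendsto_trunc : ∀ u : ℝ → ENNReal, Measurable u →
      Filter.Tendsto (fun k : ℕ => ∫⁻ x, min (u x) k) Filter.atTop (nhds (∫⁻ x, u x)) := by
    intro u hu
    refine lintegral_tendsto_of_tendsto_of_monotone
      (fun k => (hu.min measurable_const).aemeasurable)
      (Filter.Eventually.of_forall fun x k l hkl => min_le_min_left _ (by exact_mod_cast hkl))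
      (Filter.Eventually.of_forall fun x => ?_)
    simpa using (tendsto_const_nhds (x := u x)).min ENNReal.tendsto_nat_nhds_top
  have htend := ENNReal.Tendsto.mul
    ((ENNReal.continuous_rpow_const (y := 1 - t)).continuousAt.tendsto.comp (tendsto_trunc f hf))
    (Or.inl (by simp [ENNReal.rpow_eq_zero_iff, hf0, ht1, ht.2.le]))
    ((ENNReal.continuous_rpow_const (y := t)).continuousAt.tendsto.comp (tendsto_trunc g hg))
    (Or.inl (by simp [ENNReal.rpow_eq_zero_iff, hg0, ht0, ht0.le]))
  refine le_of_tendsto htend (Filter.Eventually.of_forall fun k => ?_)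
  have bdd : ∀ u : ℝ → ENNReal, ⨆ x, min (u x) (k : ENNReal) ≠ ⊤ := fun u =>
    ((iSup_le fun x => min_le_right _ _).trans_lt (ENNReal.natCast_lt_top k)).ne
  refine lintegral_rpow_mul_le_of_bounded ht (hf.min measurable_const) (hg.min measurable_const)
    hh (bdd f) (bdd g) fun x y => le_trans ?_ (H x y)
  gcongr
  · exact min_le_left _ _
  · exact min_le_left _ _

theorem PrekopaLeindler.prod {V W : Type*} [AddCommGroup V] [Module ℝ V] [MeasurableSpace V]
    [AddCommGroup W] [Module ℝ W] [MeasurableSpace W] {μ : Measure V} {ν : Measure W}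
    [SFinite ν] {t : ℝ} (hμ : PrekopaLeindler μ t) (hν : PrekopaLeindler ν t) :
    PrekopaLeindler (μ.prod ν) t := by
  intro f g h hf hg hh H
  rw [lintegral_prod _ hf.aemeasurable, lintegral_prod _ hg.aemeasurable,
    lintegral_prod _ hh.aemeasurable]
  refine hμ _ _ _ hf.lintegral_prod_right' hg.lintegral_prod_right' hh.lintegral_prod_right'
    fun x y => ?_
  refine hν _ _ _ (hf.comp measurable_prodMk_left) (hg.comp measurable_prodMk_left)
    (hh.comp measurable_prodMk_left) fun a b => ?_
  exact H (x, a) (y, b)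

theorem PrekopaLeindler.of_measurePreserving {V W : Type*} [AddCommGroup V] [Module ℝ V]
    [MeasurableSpace V] [AddCommGroup W] [Module ℝ W] [MeasurableSpace W] {μ : Measure V}
    {ν : Measure W} {t : ℝ} (e : V ≃ᵐ W) (he : MeasurePreserving e μ ν)
    (hadd : ∀ x y, e.symm ((1 - t) • x + t • y) = (1 - t) • e.symm x + t • e.symm y)
    (hμ : PrekopaLeindler μ t) : PrekopaLeindler ν t := by
  intro f g h hf hg hh H
  rw [← he.lintegral_comp hf, ← he.lintegral_comp hg, ← he.lintegral_comp hh]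
  refine hμ _ _ _ (hf.comp e.measurable) (hg.comp e.measurable) (hh.comp e.measurable)
    fun x y => ?_
  have := H (e x) (e y)
  have h2 := hadd (e x) (e y)
  simp only [e.symm_apply_apply] at h2
  rwa [← h2, e.apply_symm_apply]

theorem prekopaLeindler_pi {t : ℝ} (ht : t ∈ Ioo (0 : ℝ) 1) (n : ℕ) :
    PrekopaLeindler (volume : Measure (Fin n → ℝ)) t := by
  induction n with
  | zero =>
    intro f g h hf hg hh H
    rw [Measure.volume_pi_eq_dirac, lintegral_dirac, lintegral_dirac, lintegral_dirac]
    convert H _ _ using 2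
  | succ n ih =>
    refine PrekopaLeindler.of_measurePreserving
      (MeasurableEquiv.piFinSuccAbove (fun _ => ℝ) 0).symm
      (volume_preserving_piFinSuccAbove (fun _ => ℝ) 0).symm ?_
      ((prekopaLeindler_real ht).prod ih)
    intro x y
    rfl

theorem prekopaLeindler_euclideanSpace {t : ℝ} (ht : t ∈ Ioo (0 : ℝ) 1) (n : ℕ) :
    PrekopaLeindler (volume : Measure (EuclideanSpace ℝ (Fin n))) t :=
  PrekopaLeindler.of_measurePreserving (MeasurableEquiv.toLp 2 (Fin n → ℝ))
    (PiLp.volume_preserving_toLp (Fin n)) (fun _ _ => rfl) (prekopaLeindler_pi ht n)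

/-- The multiplicative Brunn–Minkowski inequality. -/
theorem volume_rpow_mul_le {n : ℕ} {A B C : Set (EuclideanSpace ℝ (Fin n))} {t : ℝ}
    (ht : t ∈ Ioo (0 : ℝ) 1) (hA : MeasurableSet A) (hB : MeasurableSet B) (hC : MeasurableSet C)
    (h : (1 - t) • A + t • B ⊆ C) :
    volume A ^ (1 - t) * volume B ^ t ≤ volume C := by
  have ht0 : 0 < t := ht.1
  have ht1 : 0 < 1 - t := sub_pos.2 ht.2
  have key := prekopaLeindler_euclideanSpace ht n (A.indicator 1) (B.indicator 1) (C.indicator 1)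
    (measurable_one.indicator hA) (measurable_one.indicator hB) (measurable_one.indicator hC) ?_
  · simpa [lintegral_indicator_one, hA, hB, hC] using key
  · intro x y
    by_cases hx : x ∈ A
    · by_cases hy : y ∈ B
      · have : (1 - t) • x + t • y ∈ C :=
          h (add_mem_add (smul_mem_smul_set hx) (smul_mem_smul_set hy))
        simp [hx, hy, this]
      · simp [hy, ht0]
    · simp [hx, ht1]

/-- The Brunn–Minkowski inequality. -/
theorem brunn_minkowski {n : ℕ} (hn : n ≠ 0) {A B C : Set (EuclideanSpace ℝ (Fin n))} {t : ℝ}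
    (ht : t ∈ Ioo (0 : ℝ) 1) (hA : MeasurableSet A) (hB : MeasurableSet B) (hC : MeasurableSet C)
    (hA0 : volume A ≠ 0) (hB0 : volume B ≠ 0) (hAt : volume A ≠ ⊤) (hBt : volume B ≠ ⊤)
    (hCt : volume C ≠ ⊤) (h : (1 - t) • A + t • B ⊆ C) :
    (1 - t) * (volume A).toReal ^ (1 / n : ℝ) + t * (volume B).toReal ^ (1 / n : ℝ) ≤
      (volume C).toReal ^ (1 / n : ℝ) := by
  have ht0 : 0 < t := ht.1
  have ht1 : 0 < 1 - t := sub_pos.2 ht.2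
  set a := (volume A).toReal ^ (1 / n : ℝ) with ha
  set b := (volume B).toReal ^ (1 / n : ℝ) with hb
  have hVA : 0 < (volume A).toReal := ENNReal.toReal_pos hA0 hAt
  have hVB : 0 < (volume B).toReal := ENNReal.toReal_pos hB0 hBt
  have ha0 : 0 < a := Real.rpow_pos_of_pos hVA _
  have hb0 : 0 < b := Real.rpow_pos_of_pos hVB _
  have hapow : a ^ n = (volume A).toReal := by
    rw [ha, one_div, Real.rpow_inv_natCast_pow hVA.le hn]
  have hbpow : b ^ n = (volume B).toReal := by
    rw [hb, one_div, Real.rpow_inv_natCast_pow hVB.le hn]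
  set c := (1 - t) * a + t * b with hc
  have hc0 : 0 < c := by positivity
  have hs : t * b / c ∈ Ioo (0 : ℝ) 1 := by
    refine ⟨by positivity, (div_lt_one hc0).2 ?_⟩
    have : 0 < (1 - t) * a := by positivity
    linarith
  have hs1 : 1 - t * b / c = (1 - t) * a / c := by
    field_simp; rw [hc]; ring
  have unit : ∀ (S : Set (EuclideanSpace ℝ (Fin n))) (u : ℝ), 0 < u → volume S ≠ ⊤ →
      u ^ n = (volume S).toReal → volume (u⁻¹ • S) = 1 := by
    intro S u hu hS h
    rw [Measure.addHaar_smul, finrank_euclideanSpace_fin, ← ENNReal.ofReal_toReal hS, ← h,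
      abs_of_pos (by positivity), ← ENNReal.ofReal_mul (by positivity), ← mul_pow,
      inv_mul_cancel₀ hu.ne']
    simp
  have key := volume_rpow_mul_le hs (hA.const_smul₀ a⁻¹) (hB.const_smul₀ b⁻¹)
    (hC.const_smul₀ c⁻¹) (by
      rintro _ ⟨_, ⟨_, ⟨x, hx, rfl⟩, rfl⟩, _, ⟨_, ⟨y, hy, rfl⟩, rfl⟩, rfl⟩
      refine ⟨(1 - t) • x + t • y,
        h (add_mem_add (smul_mem_smul_set hx) (smul_mem_smul_set hy)), ?_⟩
      simp only [hs1, smul_smul, smul_add]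
      congr 2 <;> field_simp)
  rw [unit A a ha0 hAt hapow, unit B b hb0 hBt hbpow, ENNReal.one_rpow, ENNReal.one_rpow, one_mul,
    Measure.addHaar_smul, finrank_euclideanSpace_fin, ← ENNReal.ofReal_toReal hCt,
    abs_of_pos (by positivity), ← ENNReal.ofReal_mul (by positivity), ENNReal.one_le_ofReal,
    inv_pow, ← div_eq_inv_mul, one_le_div (by positivity)] at key
  calc c = (c ^ n) ^ (1 / n : ℝ) := by rw [one_div, Real.pow_rpow_inv_natCast hc0.le hn]
    _ ≤ _ := Real.rpow_le_rpow (by positivity) key (by positivity)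

/-- The support function of a set. -/
def supportFun {n : ℕ} (C : Set (EuclideanSpace ℝ (Fin n))) (x : EuclideanSpace ℝ (Fin n)) : ℝ :=
  sSup ((fun y => inner ℝ x y) '' C)

section SupportFun

variable {n : ℕ} {C K : Set (EuclideanSpace ℝ (Fin n))}

theorem inner_le_supportFun (hC : IsCompact C) {y : EuclideanSpace ℝ (Fin n)} (hy : y ∈ C)
    (x : EuclideanSpace ℝ (Fin n)) : inner ℝ x y ≤ supportFun C x :=
  le_csSup (hC.image (by fun_prop)).bddAbove (mem_image_of_mem _ hy)

theorem exists_inner_eq_supportFun (hC : IsCompact C) (hC0 : C.Nonempty)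
    (x : EuclideanSpace ℝ (Fin n)) : ∃ y ∈ C, inner ℝ x y = supportFun C x :=
  (hC.image (by fun_prop)).sSup_mem (hC0.image _)

theorem supportFun_le (hC : IsCompact C) (hC0 : C.Nonempty) {x : EuclideanSpace ℝ (Fin n)} {a : ℝ}
    (h : ∀ y ∈ C, inner ℝ x y ≤ a) : supportFun C x ≤ a := by
  obtain ⟨y, hy, e⟩ := exists_inner_eq_supportFun hC hC0 x
  exact e ▸ h y hy

theorem supportFun_add_le (hC : IsCompact C) (hC0 : C.Nonempty) (x y : EuclideanSpace ℝ (Fin n)) :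
    supportFun C (x + y) ≤ supportFun C x + supportFun C y :=
  supportFun_le hC hC0 fun z hz => by
    rw [inner_add_left]
    exact add_le_add (inner_le_supportFun hC hz x) (inner_le_supportFun hC hz y)

theorem supportFun_smul_le (hC : IsCompact C) (hC0 : C.Nonempty) {t : ℝ} (ht : 0 ≤ t)
    (x : EuclideanSpace ℝ (Fin n)) : supportFun C (t • x) ≤ t * supportFun C x :=
  supportFun_le hC hC0 fun z hz => by
    rw [real_inner_smul_left]
    exact mul_le_mul_of_nonneg_left (inner_le_supportFun hC hz x) ht

theorem exists_supportFun_le_mul_norm (hC : IsCompact C) (hC0 : C.Nonempty) :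
    ∃ R : ℝ, 0 ≤ R ∧ ∀ x, supportFun C x ≤ R * ‖x‖ := by
  obtain ⟨R, hR⟩ := hC.isBounded.exists_norm_le
  refine ⟨R, (norm_nonneg _).trans (hR _ hC0.some_mem), fun x => supportFun_le hC hC0 fun y hy => ?_⟩
  calc inner ℝ x y ≤ ‖x‖ * ‖y‖ := real_inner_le_norm x y
    _ ≤ ‖x‖ * R := by gcongr; exact hR y hy
    _ = R * ‖x‖ := mul_comm _ _

theorem continuous_supportFun (hC : IsCompact C) (hC0 : C.Nonempty) :
    Continuous (supportFun C) := by
  obtain ⟨R, hR0, hR⟩ := exists_supportFun_le_mul_norm hC hC0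
  refine (LipschitzWith.of_le_add_mul ⟨R, hR0⟩ fun x y => ?_).continuous
  calc supportFun C x = supportFun C (y + (x - y)) := by simp
    _ ≤ supportFun C y + supportFun C (x - y) := supportFun_add_le hC hC0 _ _
    _ ≤ supportFun C y + R * dist x y := by rw [dist_eq_norm]; gcongr; exact hR _

theorem mem_of_forall_inner_le_supportFun (hC : IsCompact C) (hC0 : C.Nonempty)
    (hconv : Convex ℝ C) {z : EuclideanSpace ℝ (Fin n)}
    (h : ∀ v, inner ℝ v z ≤ supportFun C v) : z ∈ C := by
  by_contra hz
  obtain ⟨f, u, hf, hu⟩ := geometric_hahn_banach_closed_point hconv hC.isClosed hz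
  have := h ((InnerProductSpace.toDual ℝ _).symm f)
  rw [InnerProductSpace.toDual_symm_apply] at this
  have h2 : supportFun C ((InnerProductSpace.toDual ℝ _).symm f) ≤ u :=
    supportFun_le hC hC0 fun y hy => by
      rw [InnerProductSpace.toDual_symm_apply]; exact (hf y hy).le
  linarith

theorem supportFun_add_smul (hC : IsCompact C) (hC0 : C.Nonempty) (hK : IsCompact K)
    (hK0 : K.Nonempty) {t : ℝ} (ht : 0 ≤ t) (x : EuclideanSpace ℝ (Fin n)) :
    supportFun (C + t • K) x = supportFun C x + t * supportFun K x := by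
  have hcomp : IsCompact (C + t • K) := hC.add (hK.smul t)
  refine le_antisymm (supportFun_le hcomp (hC0.add hK0.smul_set) ?_) ?_
  · rintro _ ⟨y, hy, _, ⟨z, hz, rfl⟩, rfl⟩
    simp only [inner_add_right, real_inner_smul_right]
    exact add_le_add (inner_le_supportFun hC hy x)
      (mul_le_mul_of_nonneg_left (inner_le_supportFun hK hz x) ht)
  · obtain ⟨y, hy, ey⟩ := exists_inner_eq_supportFun hC hC0 x
    obtain ⟨z, hz, ez⟩ := exists_inner_eq_supportFun hK hK0 x
    rw [← ey, ← ez, ← real_inner_smul_right, ← inner_add_right]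
    exact inner_le_supportFun hcomp (add_mem_add hy (smul_mem_smul_set hz)) x

end SupportFun

/-- The convolution of a function with a fixed smooth probability density. -/
def mollify {n : ℕ} (f : EuclideanSpace ℝ (Fin n) → ℝ) (x : EuclideanSpace ℝ (Fin n)) : ℝ :=
  convolution ((default : ContDiffBump (0 : EuclideanSpace ℝ (Fin n))).normed volume) f
    (ContinuousLinearMap.lsmul ℝ ℝ) volume x

section Mollify

variable {n : ℕ} {f g : EuclideanSpace ℝ (Fin n) → ℝ}

theorem mollify_apply (f : EuclideanSpace ℝ (Fin n) → ℝ) (x : EuclideanSpace ℝ (Fin n)) :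
    mollify f x = ∫ t, (default : ContDiffBump (0 : EuclideanSpace ℝ (Fin n))).normed volume t *
      f (x - t) := rfl

theorem contDiff_mollify (hf : Continuous f) : ContDiff ℝ 2 (mollify f) :=
  HasCompactSupport.contDiff_convolution_left (n := 2) _ (ContDiffBump.hasCompactSupport_normed _)
    (ContDiffBump.contDiff_normed _) hf.locallyIntegrable

theorem integrable_mollify (hf : Continuous f) (x : EuclideanSpace ℝ (Fin n)) :
    Integrable fun t => (default : ContDiffBump (0 : EuclideanSpace ℝ (Fin n))).normed volume t *
      f (x - t) :=
  Continuous.integrable_of_hasCompactSupport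
    ((ContDiffBump.continuous_normed _).mul (by fun_prop))
    (ContDiffBump.hasCompactSupport_normed _).mul_right

theorem mollify_le_add (hf : Continuous f) {x y : EuclideanSpace ℝ (Fin n)} {c : ℝ}
    (h : ∀ t, f (x - t) ≤ f (y - t) + c) : mollify f x ≤ mollify f y + c := by
  have hψ := (default : ContDiffBump (0 : EuclideanSpace ℝ (Fin n))).integrable_normed (μ := volume)
  have e : mollify f y + c = ∫ t, ((default : ContDiffBump (0 : EuclideanSpace ℝ (Fin n))).normed
      volume t * f (y - t) + (default : ContDiffBump (0 : EuclideanSpace ℝ (Fin n))).normed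
      volume t * c) := by
    rw [integral_add (integrable_mollify hf y) (hψ.mul_const c), integral_mul_const,
      ContDiffBump.integral_normed, one_mul, mollify_apply]
  rw [e, mollify_apply]
  refine integral_mono (integrable_mollify hf x)
    ((integrable_mollify hf y).add (hψ.mul_const c)) fun t => ?_
  simp only
  rw [← mul_add]
  exact mul_le_mul_of_nonneg_left (h t) (ContDiffBump.nonneg_normed _ _)

theorem mollify_add_smul (hf : Continuous f) (hg : Continuous g) (c : ℝ) :
    mollify (fun x => f x + c * g x) = fun x => mollify f x + c * mollify g x := by
  ext x
  simp only [mollify_apply]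
  rw [← integral_const_mul, ← integral_add (integrable_mollify hf x)
    ((integrable_mollify hg x).const_mul c)]
  congr 1 with t
  ring

theorem convexOn_mollify (hf : Continuous f) (hconv : ConvexOn ℝ univ f) :
    ConvexOn ℝ univ (mollify f) := by
  refine ⟨convex_univ, fun x _ y _ a b ha hb hab => ?_⟩
  simp only [mollify_apply, smul_eq_mul]
  rw [← integral_const_mul, ← integral_const_mul, ← integral_add
    ((integrable_mollify hf x).const_mul a) ((integrable_mollify hf y).const_mul b)]
  refine integral_mono (integrable_mollify hf _) (((integrable_mollify hf x).const_mul a).add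
    ((integrable_mollify hf y).const_mul b)) fun t => ?_
  have h1 : a • x + b • y - t = a • (x - t) + b • (y - t) := by
    obtain rfl : b = 1 - a := by linarith
    module
  have h2 := hconv.2 (mem_univ (x - t)) (mem_univ (y - t)) ha hb hab
  have h3 := mul_le_mul_of_nonneg_left h2 (ContDiffBump.nonneg_normed (μ := volume)
    (default : ContDiffBump (0 : EuclideanSpace ℝ (Fin n))) t)
  simp only [h1, smul_eq_mul] at h3 ⊢
  linarith

end Mollify

section Smoothed

variable {n : ℕ} {C K : Set (EuclideanSpace ℝ (Fin n))}

theorem contDiff_mollify_supportFun (hC : IsCompact C) (hC0 : C.Nonempty) :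
    ContDiff ℝ 2 (mollify (supportFun C)) :=
  contDiff_mollify (continuous_supportFun hC hC0)

theorem convexOn_mollify_supportFun (hC : IsCompact C) (hC0 : C.Nonempty) :
    ConvexOn ℝ univ (mollify (supportFun C)) := by
  refine convexOn_mollify (continuous_supportFun hC hC0)
    ⟨convex_univ, fun x _ y _ a b ha hb _ => ?_⟩
  exact (supportFun_add_le hC hC0 _ _).trans
    (add_le_add (supportFun_smul_le hC hC0 ha x) (supportFun_smul_le hC hC0 hb y))

theorem mollify_supportFun_add_le (hC : IsCompact C) (hC0 : C.Nonempty)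
    (x v : EuclideanSpace ℝ (Fin n)) :
    mollify (supportFun C) (x + v) ≤ mollify (supportFun C) x + supportFun C v := by
  refine mollify_le_add (continuous_supportFun hC hC0) fun t => ?_
  rw [add_sub_right_comm]
  exact supportFun_add_le hC hC0 _ _

theorem supportFun_le_mollify (hC : IsCompact C) (hC0 : C.Nonempty) :
    ∃ M : ℝ, ∀ x, supportFun C x - M ≤ mollify (supportFun C) x := by
  obtain ⟨R, hR0, hR⟩ := exists_supportFun_le_mul_norm hC hC0
  have hc := continuous_supportFun hC hC0
  obtain ⟨ψ, hψ⟩ : ∃ ψ, ψ = (default : ContDiffBump (0 : EuclideanSpace ℝ (Fin n))) := ⟨_, rfl⟩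
  have hint := ψ.integrable_normed (μ := volume)
  refine ⟨R * ψ.rOut, fun x => ?_⟩
  have e : supportFun C x - R * ψ.rOut =
      ∫ t, ψ.normed volume t * (supportFun C x - R * ψ.rOut) := by
    rw [integral_mul_const, ContDiffBump.integral_normed, one_mul]
  rw [e, mollify_apply, ← hψ]
  refine integral_mono (hint.mul_const _) (hψ ▸ integrable_mollify hc x) fun t => ?_
  simp only
  by_cases ht : t ∈ Function.support (ψ.normed volume)
  · refine mul_le_mul_of_nonneg_left ?_ (ContDiffBump.nonneg_normed _ _)
    rw [ContDiffBump.support_normed_eq, mem_ball_zero_iff] at ht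
    have h1 := supportFun_add_le hC hC0 (x - t) t
    rw [sub_add_cancel] at h1
    have h2 : R * ‖t‖ ≤ R * ψ.rOut := mul_le_mul_of_nonneg_left ht.le hR0
    linarith [hR t]
  · rw [Function.notMem_support.1 ht]; simp

theorem mollify_supportFun_add_smul (hC : IsCompact C) (hC0 : C.Nonempty) (hK : IsCompact K)
    (hK0 : K.Nonempty) {t : ℝ} (ht : 0 ≤ t) :
    mollify (supportFun (C + t • K)) =
      fun x => mollify (supportFun C) x + t * mollify (supportFun K) x := by
  rw [← mollify_add_smul (continuous_supportFun hC hC0) (continuous_supportFun hK hK0)]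
  congr 1
  ext x
  exact supportFun_add_smul hC hC0 hK hK0 ht x

end Smoothed

section Gradient

variable {n : ℕ} {u : EuclideanSpace ℝ (Fin n) → ℝ}

theorem inner_gradient_eq_fderiv (u : EuclideanSpace ℝ (Fin n) → ℝ)
    (x v : EuclideanSpace ℝ (Fin n)) : inner ℝ v (gradient u x) = fderiv ℝ u x v := by
  rw [real_inner_comm, inner_gradient_left]

theorem contDiff_gradient (hu : ContDiff ℝ 2 u) : ContDiff ℝ 1 (gradient u) :=
  (InnerProductSpace.toDual ℝ (EuclideanSpace ℝ (Fin n))).symm.contDiff.comp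
    (hu.fderiv_right (m := 1) (by norm_num))

/-- The first-order characterization of convexity. -/
theorem ConvexOn.add_inner_gradient_le (hconv : ConvexOn ℝ univ u) (hu : Differentiable ℝ u)
    (x y : EuclideanSpace ℝ (Fin n)) : u x + inner ℝ (y - x) (gradient u x) ≤ u y := by
  have hline : ConvexOn ℝ univ (u ∘ AffineMap.lineMap (k := ℝ) x y) :=
    hconv.comp_affineMap (AffineMap.lineMap x y)
  have hd : HasDerivAt (u ∘ AffineMap.lineMap (k := ℝ) x y) (fderiv ℝ u x (y - x)) 0 := by
    have h1 : HasDerivAt (AffineMap.lineMap (k := ℝ) x y) (y - x) 0 :=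
      AffineMap.hasDerivAt_lineMap
    have h2 : HasFDerivAt u (fderiv ℝ u x) (AffineMap.lineMap (k := ℝ) x y 0) := by
      simpa using (hu x).hasFDerivAt
    exact h2.comp_hasDerivAt 0 h1
  have := hline.le_slope_of_hasDerivAt (mem_univ 0) (mem_univ 1) zero_lt_one hd
  simp only [slope_def_field, Function.comp_apply, AffineMap.lineMap_apply_one,
    AffineMap.lineMap_apply_zero, sub_zero, div_one] at this
  rw [inner_gradient_eq_fderiv]
  linarith

theorem gradient_eq_iff_forall_le (hconv : ConvexOn ℝ univ u) (hu : Differentiable ℝ u)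
    {x z : EuclideanSpace ℝ (Fin n)} :
    gradient u x = z ↔ ∀ y, u x - inner ℝ x z ≤ u y - inner ℝ y z := by
  constructor
  · rintro rfl y
    have := hconv.add_inner_gradient_le hu x y
    rw [inner_sub_left] at this
    linarith
  · intro h
    have hmin : IsLocalMin (fun y => u y - inner ℝ y z) x := Filter.Eventually.of_forall h
    have hd : HasFDerivAt (fun y => u y - inner ℝ y z) (fderiv ℝ u x - innerSL ℝ z) x := by
      refine (hu x).hasFDerivAt.sub ?_
      simpa [real_inner_comm] using (innerSL ℝ z).hasFDerivAt (x := x)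
    have h0 := hmin.hasFDerivAt_eq_zero hd
    refine ext_inner_left ℝ fun v => ?_
    have := congrArg (fun L => L v) h0
    simp only [sub_apply, innerSL_apply_apply,
      zero_apply] at this
    rw [inner_gradient_eq_fderiv, real_inner_comm]
    linarith

theorem inner_fderiv_gradient_nonneg (hconv : ConvexOn ℝ univ u) (hu : ContDiff ℝ 2 u)
    (x v : EuclideanSpace ℝ (Fin n)) : 0 ≤ inner ℝ (fderiv ℝ (gradient u) x v) v := by
  have hdiff : Differentiable ℝ u := hu.differentiable (by norm_num)
  have hG := ((contDiff_gradient hu).differentiable (by norm_num) x).hasFDerivAt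
  have hlim := hG.hasLineDerivAt v
  rw [HasLineDerivAt] at hlim
  have hd := (hlim.inner ℝ (hasDerivAt_const 0 v))
  simp only [inner_zero_right, zero_add] at hd
  refine ge_of_tendsto hd.tendsto_slope_zero_right ?_
  filter_upwards [self_mem_nhdsWithin] with s hs
  have hs0 : (0 : ℝ) < s := hs
  have h1 := hconv.add_inner_gradient_le hdiff x (x + s • v)
  have h2 := hconv.add_inner_gradient_le hdiff (x + s • v) x
  rw [add_sub_cancel_left, real_inner_smul_left] at h1
  rw [sub_add_cancel_left, inner_neg_left, real_inner_smul_left] at h2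
  simp only [zero_add, zero_smul, add_zero, smul_eq_mul]
  refine mul_nonneg (inv_nonneg.2 hs0.le) ?_
  rw [real_inner_comm v, real_inner_comm v]
  nlinarith

theorem det_nonneg_of_inner_nonneg {E : Type*} [NormedAddCommGroup E] [InnerProductSpace ℝ E]
    [FiniteDimensional ℝ E] {A : E →L[ℝ] E} (hA : ∀ v, 0 ≤ inner ℝ (A v) v) : 0 ≤ A.det := by
  have hcont : Continuous fun s : ℝ => ((1 - s) • A + s • ContinuousLinearMap.id ℝ E).det :=
    ContinuousLinearMap.continuous_det.comp (by fun_prop)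
  have hne : ∀ s ∈ Ioc (0 : ℝ) 1, ((1 - s) • A + s • ContinuousLinearMap.id ℝ E).det ≠ 0 := by
    intro s hs h0
    have : LinearMap.det (((1 - s) • A + s • ContinuousLinearMap.id ℝ E : E →L[ℝ] E) : E →ₗ[ℝ] E)
      = 0 := h0
    obtain ⟨v, hv, hv0⟩ := Submodule.exists_mem_ne_zero_of_ne_bot
      (LinearMap.bot_lt_ker_of_det_eq_zero this).ne'
    have hv' : (1 - s) • A v + s • v = 0 := hv
    have h1 := congrArg (fun w => inner ℝ w v) hv'
    simp only [inner_add_left, real_inner_smul_left, inner_zero_left,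
      real_inner_self_eq_norm_sq] at h1
    have h2 : 0 ≤ (1 - s) * inner ℝ (A v) v := mul_nonneg (by linarith [hs.2]) (hA v)
    have h3 : 0 < s * ‖v‖ ^ 2 := mul_pos hs.1 (by positivity)
    linarith
  by_contra! hneg
  have h1 : (0 : ℝ) ∈ Icc ((1 - 0 : ℝ) • A + (0 : ℝ) • ContinuousLinearMap.id ℝ E).det
      ((1 - 1 : ℝ) • A + (1 : ℝ) • ContinuousLinearMap.id ℝ E).det := by
    constructor
    · simpa using hneg.le
    · simp [ContinuousLinearMap.det]
  obtain ⟨s, hs, hs0⟩ := intermediate_value_Icc zero_le_one hcont.continuousOn h1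
  rcases hs.1.eq_or_lt with rfl | hspos
  · simp at hs0
    exact hneg.ne hs0
  · exact hne s ⟨hspos, hs.2⟩ hs0

theorem injOn_gradient (hconv : ConvexOn ℝ univ u) (hu : ContDiff ℝ 2 u) :
    InjOn (gradient u) {x | (fderiv ℝ (gradient u) x).det ≠ 0} := by
  intro a ha b _ hab
  by_contra hne
  have hdiff : Differentiable ℝ u := hu.differentiable (by norm_num)
  have hconst : ∀ s ∈ Icc (0 : ℝ) 1, gradient u (a + s • (b - a)) = gradient u a := by
    intro s hs
    have ha' := (gradient_eq_iff_forall_le hconv hdiff).1 (rfl : gradient u a = gradient u a)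
    have hb' := (gradient_eq_iff_forall_le hconv hdiff).1 hab.symm
    refine (gradient_eq_iff_forall_le hconv hdiff).2 fun y => ?_
    have h1 : a + s • (b - a) = (1 - s) • a + s • b := by module
    have h2 := hconv.2 (mem_univ a) (mem_univ b) (sub_nonneg.2 hs.2) hs.1 (by ring)
    rw [h1, inner_add_left, real_inner_smul_left, real_inner_smul_left]
    simp only [smul_eq_mul] at h2
    nlinarith [mul_le_mul_of_nonneg_left (ha' y) (sub_nonneg.2 hs.2),
      mul_le_mul_of_nonneg_left (hb' y) hs.1]
  have hG := ((contDiff_gradient hu).differentiable (by norm_num) a).hasFDerivAt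
  have hd : HasDerivAt (fun s : ℝ => gradient u (a + s • (b - a)))
    (fderiv ℝ (gradient u) a (b - a)) 0 := hG.hasLineDerivAt (b - a)
  have hd0 : HasDerivWithinAt (fun s : ℝ => gradient u (a + s • (b - a))) 0 (Icc 0 1) 0 :=
    (hasDerivWithinAt_const 0 _ (gradient u a)).congr hconst (by simp)
  have h0 : fderiv ℝ (gradient u) a (b - a) = 0 :=
    (uniqueDiffOn_Icc_zero_one 0 (by simp)).eq_deriv _ hd.hasDerivWithinAt hd0
  refine ha (LinearMap.det_eq_zero_iff_ker_ne_bot.2 fun hbot => ?_)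
  have hmem : b - a ∈ LinearMap.ker
      ((fderiv ℝ (gradient u) a : EuclideanSpace ℝ (Fin n) →L[ℝ] EuclideanSpace ℝ (Fin n)) :
        EuclideanSpace ℝ (Fin n) →ₗ[ℝ] EuclideanSpace ℝ (Fin n)) := h0
  rw [hbot, Submodule.mem_bot, sub_eq_zero] at hmem
  exact hne hmem.symm

theorem lintegral_det_fderiv_gradient (hconv : ConvexOn ℝ univ u) (hu : ContDiff ℝ 2 u) :
    ∫⁻ x, ENNReal.ofReal (fderiv ℝ (gradient u) x).det = volume (range (gradient u)) := by
  have hG : ∀ x, HasFDerivAt (gradient u) (fderiv ℝ (gradient u) x) x := fun x =>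
    ((contDiff_gradient hu).differentiable (by norm_num) x).hasFDerivAt
  have hcont : Continuous fun x => (fderiv ℝ (gradient u) x).det :=
    ContinuousLinearMap.continuous_det.comp ((contDiff_gradient hu).continuous_fderiv (by norm_num))
  set S := {x | (fderiv ℝ (gradient u) x).det ≠ 0} with hS
  have hSm : MeasurableSet S := (isOpen_ne_fun hcont continuous_const).measurableSet
  have hnull : volume (gradient u '' Sᶜ) = 0 :=
    addHaar_image_eq_zero_of_det_fderivWithin_eq_zero volume
      (fun x _ => (hG x).hasFDerivWithinAt) fun x hx => not_not.1 hx
  have hrange : volume (range (gradient u)) = volume (gradient u '' S) := by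
    rw [← image_univ, ← union_compl_self S, image_union]
    exact le_antisymm ((measure_union_le _ _).trans (by rw [hnull, add_zero]))
      (measure_mono subset_union_left)
  rw [hrange, ← lintegral_abs_det_fderiv_eq_addHaar_image volume hSm
    (fun x _ => (hG x).hasFDerivWithinAt) (injOn_gradient hconv hu),
    ← lintegral_add_compl _ hSm, setLIntegral_eq_zero hSm.compl, add_zero]
  · refine setLIntegral_congr_fun hSm fun x _ => ?_
    rw [abs_of_nonneg (det_nonneg_of_inner_nonneg (inner_fderiv_gradient_nonneg hconv hu x))]
  · intro x hx
    have : (fderiv ℝ (gradient u) x).det = 0 := not_not.1 hx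
    simp [this]

end Gradient

section Steiner

variable {n : ℕ} {C K : Set (EuclideanSpace ℝ (Fin n))}

theorem range_gradient_mollify_supportFun_subset (hC : IsCompact C) (hC0 : C.Nonempty)
    (hconv : Convex ℝ C) : range (gradient (mollify (supportFun C))) ⊆ C := by
  rintro _ ⟨x, rfl⟩
  refine mem_of_forall_inner_le_supportFun hC hC0 hconv fun v => ?_
  rw [inner_gradient_eq_fderiv]
  have hd : HasLineDerivAt ℝ (mollify (supportFun C)) _ x v :=
    ((contDiff_mollify_supportFun hC hC0).differentiable (by norm_num) x).hasFDerivAt.hasLineDerivAt v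
  refine le_of_tendsto hd.tendsto_slope_zero_right ?_
  filter_upwards [self_mem_nhdsWithin] with s hs
  have hs0 : (0 : ℝ) < s := hs
  rw [smul_eq_mul, inv_mul_le_iff₀ hs0]
  have h1 := mollify_supportFun_add_le hC hC0 x (s • v)
  have h2 := supportFun_smul_le hC hC0 hs0.le v
  linarith

theorem interior_subset_range_gradient_mollify_supportFun (hC : IsCompact C) (hC0 : C.Nonempty) :
    interior C ⊆ range (gradient (mollify (supportFun C))) := by
  intro z hz
  obtain ⟨δ, hδ, hball⟩ := Metric.nhds_basis_closedBall.mem_iff.1 (mem_interior_iff_mem_nhds.1 hz)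
  obtain ⟨M, hM⟩ := supportFun_le_mollify hC hC0
  have hu := contDiff_mollify_supportFun hC hC0
  have hcont : Continuous fun y => mollify (supportFun C) y - inner ℝ y z :=
    hu.continuous.sub (by fun_prop)
  have hlow : ∀ y, δ * ‖y‖ - M ≤ mollify (supportFun C) y - inner ℝ y z := by
    intro y
    rcases eq_or_ne y 0 with rfl | hy
    · have := hM 0
      have h2 := inner_le_supportFun hC hC0.some_mem 0
      simp only [inner_zero_left, norm_zero, mul_zero] at h2 ⊢
      linarith
    · have hy0 : 0 < ‖y‖ := norm_pos_iff.2 hy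
      have hmem : z + (δ * ‖y‖⁻¹) • y ∈ C := hball (by
        rw [mem_closedBall_iff_norm, add_sub_cancel_left, norm_smul, Real.norm_of_nonneg
          (by positivity), mul_assoc, inv_mul_cancel₀ hy0.ne', mul_one])
      have h1 := inner_le_supportFun hC hmem y
      rw [inner_add_right, real_inner_smul_right, real_inner_self_eq_norm_sq] at h1
      have h2 : δ * ‖y‖⁻¹ * ‖y‖ ^ 2 = δ * ‖y‖ := by field_simp
      linarith [hM y]
  obtain ⟨x, hx⟩ := hcont.exists_forall_le (Filter.tendsto_atTop_mono hlow
    (Filter.tendsto_atTop_add_const_right _ _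
      ((tendsto_norm_cocompact_atTop).const_mul_atTop hδ)))
  exact ⟨x, (gradient_eq_iff_forall_le (convexOn_mollify_supportFun hC hC0)
    (hu.differentiable (by norm_num))).2 hx⟩

theorem volume_interior_eq (hconv : Convex ℝ C) : volume (interior C) = volume C := by
  refine le_antisymm (measure_mono interior_subset) ?_
  calc volume C ≤ volume (interior C ∪ frontier C) :=
        measure_mono (subset_closure.trans (closure_eq_interior_union_frontier C).subset)
    _ ≤ volume (interior C) + volume (frontier C) := measure_union_le _ _
    _ = volume (interior C) := by rw [hconv.addHaar_frontier volume, add_zero]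

theorem lintegral_det_fderiv_gradient_supportFun (hC : IsCompact C) (hC0 : C.Nonempty)
    (hconv : Convex ℝ C) :
    ∫⁻ x, ENNReal.ofReal (fderiv ℝ (gradient (mollify (supportFun C))) x).det = volume C := by
  rw [lintegral_det_fderiv_gradient (convexOn_mollify_supportFun hC hC0)
    (contDiff_mollify_supportFun hC hC0)]
  exact le_antisymm (measure_mono (range_gradient_mollify_supportFun_subset hC hC0 hconv))
    ((volume_interior_eq hconv).symm.trans_le
      (measure_mono (interior_subset_range_gradient_mollify_supportFun hC hC0)))

theorem det_fderiv_gradient_supportFun_nonneg (hC : IsCompact C) (hC0 : C.Nonempty)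
    (x : EuclideanSpace ℝ (Fin n)) :
    0 ≤ (fderiv ℝ (gradient (mollify (supportFun C))) x).det :=
  det_nonneg_of_inner_nonneg (inner_fderiv_gradient_nonneg
    (convexOn_mollify_supportFun hC hC0) (contDiff_mollify_supportFun hC hC0) x)

theorem integrable_det_fderiv_gradient_supportFun (hC : IsCompact C) (hC0 : C.Nonempty)
    (hconv : Convex ℝ C) :
    Integrable fun x => (fderiv ℝ (gradient (mollify (supportFun C))) x).det := by
  have hcont : Continuous fun x => (fderiv ℝ (gradient (mollify (supportFun C))) x).det :=
    ContinuousLinearMap.continuous_det.comp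
      ((contDiff_gradient (contDiff_mollify_supportFun hC hC0)).continuous_fderiv (by norm_num))
  refine (lintegral_ofReal_ne_top_iff_integrable hcont.aestronglyMeasurable
    (Filter.Eventually.of_forall (det_fderiv_gradient_supportFun_nonneg hC hC0))).1 ?_
  rw [lintegral_det_fderiv_gradient_supportFun hC hC0 hconv]
  exact hC.measure_ne_top

theorem integral_det_fderiv_gradient_supportFun (hC : IsCompact C) (hC0 : C.Nonempty)
    (hconv : Convex ℝ C) :
    ∫ x, (fderiv ℝ (gradient (mollify (supportFun C))) x).det = (volume C).toReal := by
  rw [integral_eq_lintegral_of_nonneg_ae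
    (Filter.Eventually.of_forall (det_fderiv_gradient_supportFun_nonneg hC hC0))
    (integrable_det_fderiv_gradient_supportFun hC hC0 hconv).aestronglyMeasurable,
    lintegral_det_fderiv_gradient_supportFun hC hC0 hconv]

theorem fderiv_gradient_supportFun_add_smul (hC : IsCompact C) (hC0 : C.Nonempty)
    (hK : IsCompact K) (hK0 : K.Nonempty) {t : ℝ} (ht : 0 ≤ t) (x : EuclideanSpace ℝ (Fin n)) :
    fderiv ℝ (gradient (mollify (supportFun (C + t • K)))) x =
      fderiv ℝ (gradient (mollify (supportFun C))) x +
        t • fderiv ℝ (gradient (mollify (supportFun K))) x := by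
  have hu := contDiff_mollify_supportFun hC hC0
  have hv := contDiff_mollify_supportFun hK hK0
  have hgrad : gradient (mollify (supportFun (C + t • K))) =
      gradient (mollify (supportFun C)) + t • gradient (mollify (supportFun K)) := by
    ext1 y
    have h1 := (hu.differentiable (by norm_num) y).hasFDerivAt
    have h2 := (hv.differentiable (by norm_num) y).hasFDerivAt
    have h3 := (h1.fun_add (h2.const_mul t)).fderiv
    refine ext_inner_left ℝ fun v => ?_
    rw [mollify_supportFun_add_smul hC hC0 hK hK0 ht, inner_gradient_eq_fderiv, h3]
    simp [inner_add_right, real_inner_smul_right]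
  rw [hgrad]
  have h1 := (contDiff_gradient hu).differentiable (by norm_num) x
  have h2 := (contDiff_gradient hv).differentiable (by norm_num) x
  exact (h1.hasFDerivAt.add (h2.hasFDerivAt.const_smul t)).fderiv

/-- The Lagrange basis polynomials of the nodes `0, …, n`. -/
def steinerBasis (n i : ℕ) : Polynomial ℝ :=
  Lagrange.basis (Finset.range (n + 1)) (fun j : ℕ => (j : ℝ)) i

theorem det_add_smul_eq_sum (A B : EuclideanSpace ℝ (Fin n) →L[ℝ] EuclideanSpace ℝ (Fin n))
    (t : ℝ) : (A + t • B).det =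
      ∑ i ∈ Finset.range (n + 1), (steinerBasis n i).eval t * (A + (i : ℝ) • B).det := by
  set b := (EuclideanSpace.basisFun (Fin n) ℝ).toBasis
  set MA := LinearMap.toMatrix b b (A : _ →ₗ[ℝ] _)
  set MB := LinearMap.toMatrix b b (B : _ →ₗ[ℝ] _)
  set P := Matrix.det ((Polynomial.X : Polynomial ℝ) • MB.map Polynomial.C + MA.map Polynomial.C)
  have hP : ∀ s, P.eval s = (A + s • B).det := by
    intro s
    have h1 : (A + s • B).det = (MA + s • MB).det := by
      rw [ContinuousLinearMap.det, ← LinearMap.det_toMatrix b]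
      simp [MA, MB]
    rw [h1]
    simp only [P]
    rw [← Polynomial.coe_evalRingHom, RingHom.map_det]
    congr 1
    ext i j
    simp [add_comm, mul_comm s]
  have hdeg : P.degree < (Finset.range (n + 1)).card := by
    refine lt_of_le_of_lt Polynomial.degree_le_natDegree ?_
    have := Polynomial.natDegree_det_X_add_C_le MB MA
    rw [Fintype.card_fin] at this
    rw [Finset.card_range]
    exact_mod_cast Nat.lt_succ_of_le this
  have hinj : InjOn (fun j : ℕ => (j : ℝ)) (Finset.range (n + 1) : Set ℕ) :=
    fun i _ j _ h => Nat.cast_injective h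
  have := Lagrange.eq_interpolate_of_eval_eq (fun i : ℕ => (A + (i : ℝ) • B).det) hinj hdeg
    fun i _ => hP i
  rw [← hP, this, Lagrange.interpolate_apply, Polynomial.eval_finsetSum]
  simp [steinerBasis, mul_comm]

/-- The volume of `C + t • K` is a polynomial in `t ≥ 0`, expressed here through its values at
`0, …, n`. -/
theorem volume_add_smul_eq_sum (hC : IsCompact C) (hC0 : C.Nonempty) (hCconv : Convex ℝ C)
    (hK : IsCompact K) (hK0 : K.Nonempty) (hKconv : Convex ℝ K) {t : ℝ} (ht : 0 ≤ t) :
    (volume (C + t • K)).toReal = ∑ i ∈ Finset.range (n + 1),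
      (steinerBasis n i).eval t * (volume (C + (i : ℝ) • K)).toReal := by
  have hcomp : ∀ s : ℝ, IsCompact (C + s • K) := fun s => hC.add (hK.smul s)
  have hne : ∀ s : ℝ, (C + s • K).Nonempty := fun s => hC0.add hK0.smul_set
  have hcv : ∀ s : ℝ, Convex ℝ (C + s • K) := fun s => hCconv.add (hKconv.smul s)
  have hdet := fun s hs x => congrArg ContinuousLinearMap.det
    (fderiv_gradient_supportFun_add_smul hC hC0 hK hK0 (t := s) hs x)
  rw [← integral_det_fderiv_gradient_supportFun (hcomp t) (hne t) (hcv t)]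
  simp_rw [← fun s => integral_det_fderiv_gradient_supportFun (hcomp s) (hne s) (hcv s)]
  simp_rw [← integral_const_mul]
  rw [← integral_finsetSum]
  · congr 1 with x
    rw [hdet t ht, det_add_smul_eq_sum]
    exact Finset.sum_congr rfl fun i _ => by rw [hdet i i.cast_nonneg]
  · intro i _
    exact (integrable_det_fderiv_gradient_supportFun (hcomp i) (hne i) (hcv i)).const_mul _

theorem hasDerivWithinAt_volume_add_smul (hC : IsCompact C) (hC0 : C.Nonempty)
    (hCconv : Convex ℝ C) (hK : IsCompact K) (hK0 : K.Nonempty) (hKconv : Convex ℝ K) :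
    HasDerivWithinAt (fun t : ℝ => (volume (C + t • K)).toReal)
      (∑ i ∈ Finset.range (n + 1),
        (steinerBasis n i).derivative.eval 0 * (volume (C + (i : ℝ) • K)).toReal) (Ici 0) 0 := by
  refine HasDerivWithinAt.congr (f := fun t => ∑ i ∈ Finset.range (n + 1),
      (steinerBasis n i).eval t * (volume (C + (i : ℝ) • K)).toReal) ?_
    (fun t ht => volume_add_smul_eq_sum hC hC0 hCconv hK hK0 hKconv ht)
    (volume_add_smul_eq_sum hC hC0 hCconv hK hK0 hKconv le_rfl)
  exact HasDerivWithinAt.fun_sum fun i _ =>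
    ((steinerBasis n i).hasDerivAt 0).hasDerivWithinAt.mul_const _

theorem aniPer_eq_sum (hC : IsCompact C) (hC0 : C.Nonempty)
    (hCconv : Convex ℝ C) (hK : IsCompact K) (hK0 : K.Nonempty) (hKconv : Convex ℝ K) :
    aniPer C K = ∑ i ∈ Finset.range (n + 1),
      (steinerBasis n i).derivative.eval 0 * (volume (C + (i : ℝ) • K)).toReal :=
  (hasDerivWithinAt_volume_add_smul hC hC0 hCconv hK hK0 hKconv).derivWithin
    (uniqueDiffOn_Ici 0 0 self_mem_Ici)

end Steiner

section InnerParallelVariation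
open Filter Topology
variable {n : ℕ} {D K : Set (EuclideanSpace ℝ (Fin n))}

theorem mem_smul_of_gauge_le (hconv : Convex ℝ D) (hclosed : IsClosed D)
    (h0 : D ∈ 𝓝 (0 : EuclideanSpace ℝ (Fin n))) {x : EuclideanSpace ℝ (Fin n)} {a : ℝ}
    (ha : 0 < a) (hx : gauge D x ≤ a) : x ∈ a • D := by
  rw [mem_smul_set_iff_inv_smul_mem₀ ha.ne', ← hclosed.closure_eq,
    ← gauge_le_one_iff_mem_closure hconv h0, gauge_smul_of_nonneg (inv_nonneg.2 ha.le),
    smul_eq_mul, inv_mul_le_iff₀ ha, mul_one]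
  exact hx

theorem eventually_gauge_add_gauge_le (hDconv : Convex ℝ D) (hDc : IsCompact D)
    (hD0 : D ∈ 𝓝 (0 : EuclideanSpace ℝ (Fin n))) (hK : IsCompact K) (hK0 : K.Nonempty)
    {x : EuclideanSpace ℝ (Fin n)} (hx0 : x ≠ 0) (hdiff : DifferentiableAt ℝ (gauge D) x)
    {ε : ℝ} (hε : 0 < ε) :
    ∀ᶠ h : ℝ in 𝓝[>] 0,
      gauge (innerPar D K h) x + gauge (D + h • K) x - 2 * gauge D x ≤ ε * h := by
  have hc : 0 < gauge D x :=
    (gauge_pos (absorbent_nhds_zero hD0) (hDc.isVonNBounded ℝ)).2 hx0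
  obtain ⟨R, hR, hRK⟩ := hK.isBounded.exists_pos_norm_le
  obtain ⟨y₀, hy₀, hmax⟩ := hK.exists_isMaxOn hK0 (fderiv ℝ (gauge D) x).continuous.continuousOn
  set c := gauge D x with hcdef
  set ξ := fderiv ℝ (gauge D) x with hξ
  set k := ξ y₀ with hk
  set m := ε / (4 * c) with hm
  have hm0 : 0 < m := by positivity
  have hmc : 4 * c * m = ε := by rw [hm]; field_simp
  have hlin := hdiff.hasFDerivAt.isLittleO.def (show 0 < m / R by positivity)
  obtain ⟨δ, hδ, hball⟩ := Metric.eventually_nhds_iff.1 hlin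
  have hbound : ∀ y ∈ K, ∀ s : ℝ, |s| * R < δ →
      gauge D (x + s • y) ≤ c + s * ξ y + |s| * m := by
    intro y hy s hs
    have hn : ‖s • y‖ ≤ |s| * R := by
      rw [norm_smul, Real.norm_eq_abs]
      exact mul_le_mul_of_nonneg_left (hRK y hy) (abs_nonneg s)
    have h1 := @hball (x + s • y) (by rw [dist_eq_norm, add_sub_cancel_left]; linarith)
    rw [add_sub_cancel_left, Real.norm_eq_abs, map_smul, smul_eq_mul] at h1
    have h2 : m / R * ‖s • y‖ ≤ |s| * m := by
      calc m / R * ‖s • y‖ ≤ m / R * (|s| * R) := by gcongr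
        _ = |s| * m := by field_simp
    linarith [(abs_le.1 h1).2]
  have hlim : ∀ {f : ℝ → ℝ} {b : ℝ}, Continuous f → f 0 < b → ∀ᶠ h in 𝓝[>] 0, f h < b :=
    fun hf hb => nhdsWithin_le_nhds ((hf.tendsto 0).eventually_lt_const hb)
  filter_upwards [self_mem_nhdsWithin,
    hlim (f := fun h => h * (k + 2 * m) * (k + m)) (b := m) (by fun_prop) (by simpa using hm0),
    hlim (f := fun h => h * (k - 2 * m) * (k - m)) (b := m) (by fun_prop) (by simpa using hm0),
    hlim (f := fun h => |(c + c * h * (k + 2 * m)) * h| * R) (by fun_prop) (by simpa using hδ),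
    hlim (f := fun h => |-((c - c * h * (k - 2 * m)) * h)| * R) (by fun_prop) (by simpa using hδ),
    hlim (f := fun h => -(c + c * h * (k + 2 * m))) (b := 0) (by fun_prop) (by simpa using hc),
    hlim (f := fun h => -(c - c * h * (k - 2 * m))) (b := 0) (by fun_prop) (by simpa using hc)]
    with h (hh : 0 < h) h1 h2 h3 h4 h5 h6
  set a := c + c * h * (k + 2 * m) with ha
  set b := c - c * h * (k - 2 * m) with hb
  have ha0 : 0 < a := by linarith
  have hb0 : 0 < b := by linarith
  have hca : c + a * h * (k + m) ≤ a := by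
    have : a * h * (k + m) = c * h * (k + m + h * (k + 2 * m) * (k + m)) := by rw [ha]; ring
    have h7 : c * h * (k + m + h * (k + 2 * m) * (k + m)) ≤ c * h * (k + m + m) := by gcongr
    rw [this]
    linarith
  have hcb : c - b * h * (k - m) ≤ b := by
    have : b * h * (k - m) = c * h * (k - m - h * (k - 2 * m) * (k - m)) := by rw [hb]; ring
    have h7 : c * h * (k - m - m) ≤ c * h * (k - m - h * (k - 2 * m) * (k - m)) := by gcongr
    rw [this]
    linarith
  have hga : gauge (innerPar D K h) x ≤ a := by
    refine gauge_le_of_mem ha0.le ⟨a⁻¹ • x, fun y hy => ?_, smul_inv_smul₀ ha0.ne' x⟩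
    have h7 := hbound y hy (a * h) h3
    rw [abs_of_pos (by positivity)] at h7
    have h8 : a * h * ξ y ≤ a * h * k := by
      have := hmax hy
      gcongr
      exact this
    have h9 := mem_smul_of_gauge_le hDconv hDc.isClosed hD0 ha0
      (h7.trans (by linarith : c + a * h * ξ y + a * h * m ≤ a))
    rw [mem_smul_set_iff_inv_smul_mem₀ ha0.ne', smul_add, smul_smul, ← mul_assoc,
      inv_mul_cancel₀ ha0.ne', one_mul] at h9
    exact h9
  have hgb : gauge (D + h • K) x ≤ b := by
    refine gauge_le_of_mem hb0.le ⟨b⁻¹ • x, ?_, smul_inv_smul₀ hb0.ne' x⟩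
    have h7 := hbound y₀ hy₀ (-(b * h)) h4
    rw [abs_neg, abs_of_pos (by positivity)] at h7
    have h9 := mem_smul_of_gauge_le hDconv hDc.isClosed hD0 hb0
      (h7.trans (by linarith : c + -(b * h) * k + b * h * m ≤ b))
    rw [mem_smul_set_iff_inv_smul_mem₀ hb0.ne', smul_add, smul_smul, mul_neg, ← mul_assoc,
      inv_mul_cancel₀ hb0.ne', one_mul, neg_smul] at h9
    exact ⟨_, h9, h • y₀, ⟨y₀, hy₀, rfl⟩, by simp⟩
  rw [← hmc]
  linarith

theorem integrable_max_gauge_and_integral_eq (hconv : Convex ℝ D)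
    (h0 : D ∈ 𝓝 (0 : EuclideanSpace ℝ (Fin n))) (hfin : volume D ≠ ⊤) :
    Integrable (fun x => max 0 (1 - gauge D x)) ∧
      ∫ x, max 0 (1 - gauge D x) = (volume D).toReal / (n + 1) := by
  have hcont : Continuous fun x => max 0 (1 - gauge D x) := by
    have := continuous_gauge hconv h0
    fun_prop
  have hnn : 0 ≤ᵐ[volume] fun x => max 0 (1 - gauge D x) :=
    Eventually.of_forall fun x => le_max_left _ _
  have hκ : ∫⁻ t in Ioo (0 : ℝ) 1, ENNReal.ofReal ((1 - t) ^ n) = ENNReal.ofReal (1 / (n + 1)) := by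
    rw [← ofReal_integral_eq_lintegral_ofReal]
    · rw [← integral_Ioc_eq_integral_Ioo, ← intervalIntegral.integral_of_le zero_le_one,
        intervalIntegral.integral_comp_sub_left (fun x => x ^ n)]
      simp
    · exact ((by fun_prop : Continuous fun t : ℝ => (1 - t) ^ n).integrableOn_Icc).mono_set
        Ioo_subset_Icc_self
    · exact (ae_restrict_iff' measurableSet_Ioo).2
        (Eventually.of_forall fun t ht => pow_nonneg (by linarith [ht.2]) n)
  have hlin : ∫⁻ x, ENNReal.ofReal (max 0 (1 - gauge D x)) =
      ENNReal.ofReal (1 / (n + 1)) * volume D := by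
    rw [lintegral_eq_lintegral_meas_lt volume hnn hcont.aemeasurable, ← hκ,
      ← lintegral_mul_const' _ _ hfin, ← lintegral_indicator measurableSet_Ioi,
      ← lintegral_indicator measurableSet_Ioo]
    congr 1
    ext t
    by_cases ht0 : 0 < t
    swap
    · rw [indicator_of_notMem (by simpa using ht0), indicator_of_notMem (fun h => ht0 h.1)]
    rw [indicator_of_mem (by simpa using ht0)]
    by_cases ht1 : t < 1
    swap
    · rw [indicator_of_notMem (fun h => ht1 h.2)]
      convert measure_empty (μ := volume)
      ext x
      simp only [mem_ofPred_eq, mem_empty_iff_false, iff_false, not_lt]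
      exact max_le ht0.le (by linarith [gauge_nonneg (s := D) x])
    rw [indicator_of_mem (by exact ⟨ht0, ht1⟩)]
    have hpos : 0 < 1 - t := by linarith
    have hset : {x | t < max 0 (1 - gauge D x)} = (1 - t) • interior D := by
      ext x
      rw [mem_smul_set_iff_inv_smul_mem₀ hpos.ne', ← gauge_lt_one_iff_mem_interior hconv h0,
        gauge_smul_of_nonneg (inv_nonneg.2 hpos.le), smul_eq_mul, inv_mul_lt_iff₀ hpos, mul_one]
      simp only [mem_ofPred_eq, lt_max_iff, ht0.not_gt, false_or]
      constructor <;> intro h <;> linarith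
    rw [hset, Measure.addHaar_smul, finrank_euclideanSpace_fin, abs_of_nonneg (by positivity),
      volume_interior_eq hconv]
  have hint : Integrable fun x => max 0 (1 - gauge D x) := by
    rw [← lintegral_ofReal_ne_top_iff_integrable hcont.aestronglyMeasurable hnn, hlin]
    finiteness
  refine ⟨hint, ?_⟩
  rw [integral_eq_lintegral_of_nonneg_ae hnn hcont.aestronglyMeasurable, hlin, ENNReal.toReal_mul,
    ENNReal.toReal_ofReal (by positivity)]
  ring

end InnerParallelVariation

section InnerParallelBody
variable {n : ℕ} {D K : Set (EuclideanSpace ℝ (Fin n))}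

theorem convex_innerPar (hD : Convex ℝ D) (K : Set (EuclideanSpace ℝ (Fin n))) (h : ℝ) :
    Convex ℝ (innerPar D K h) := by
  intro x hx z hz a b ha hb hab y hy
  convert hD (hx y hy) (hz y hy) ha hb hab using 1
  rw [smul_add, smul_add, add_add_add_comm, ← add_smul, hab, one_smul]

theorem isClosed_innerPar (hD : IsClosed D) (K : Set (EuclideanSpace ℝ (Fin n))) (h : ℝ) :
    IsClosed (innerPar D K h) := by
  have : innerPar D K h = ⋂ y ∈ K, (fun x => x + h • y) ⁻¹' D := by
    ext x
    simp [innerPar]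
  rw [this]
  exact isClosed_biInter fun y _ => hD.preimage (by fun_prop)

theorem isCompact_innerPar (hD : IsCompact D) (hK : K.Nonempty) (h : ℝ) :
    IsCompact (innerPar D K h) := by
  obtain ⟨y, hy⟩ := hK
  refine (hD.image (f := fun x => x - h • y) (by fun_prop)).of_isClosed_subset
    (isClosed_innerPar hD.isClosed K h) fun x hx => ⟨x + h • y, hx y hy, by simp⟩

theorem convex_add_smul (hD : Convex ℝ D) (hK : Convex ℝ K) (h : ℝ) : Convex ℝ (D + h • K) :=
  hD.add (hK.smul h)

theorem isCompact_add_smul (hD : IsCompact D) (hK : IsCompact K) (h : ℝ) :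
    IsCompact (D + h • K) :=
  hD.add (hK.smul h)

end InnerParallelBody

section InnerParallelVariation
open Filter Topology
variable {n : ℕ} {D K : Set (EuclideanSpace ℝ (Fin n))}

/-- Near the origin, `K` is contained in a dilate of `D`, so `D ∼ hK` contains `(1 - Rh)D`. -/
theorem exists_smul_subset_innerPar (hDconv : Convex ℝ D)
    (hD0 : D ∈ 𝓝 (0 : EuclideanSpace ℝ (Fin n))) (hK : IsCompact K) :
    ∃ R : ℝ, 0 < R ∧ ∀ h : ℝ, 0 ≤ h → R * h < 1 → (1 - R * h) • D ⊆ innerPar D K h := by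
  obtain ⟨ε, hε, hεD⟩ := Metric.nhds_basis_closedBall.mem_iff.1 hD0
  obtain ⟨R₀, hR₀, hRK⟩ := hK.isBounded.exists_pos_norm_le
  refine ⟨R₀ / ε, by positivity, fun h hh hlt => ?_⟩
  rintro _ ⟨x, hx, rfl⟩ y hy
  have hy' : (ε / R₀) • y ∈ D := hεD <| by
    rw [mem_closedBall_zero_iff, norm_smul, Real.norm_of_nonneg (by positivity)]
    calc ε / R₀ * ‖y‖ ≤ ε / R₀ * R₀ := by gcongr; exact hRK y hy
      _ = ε := by field_simp
  convert hDconv hx hy' (sub_nonneg.2 hlt.le) (by positivity : 0 ≤ R₀ / ε * h) (by ring) using 2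
  rw [smul_smul]
  congr 1
  field_simp

theorem exists_tendsto_volume_defect_le_of_mem_nhds (hDconv : Convex ℝ D) (hDc : IsCompact D)
    (hD0 : D ∈ 𝓝 (0 : EuclideanSpace ℝ (Fin n))) (hKconv : Convex ℝ K) (hK : IsCompact K)
    (hK0 : (0 : EuclideanSpace ℝ (Fin n)) ∈ K) :
    ∃ e : ℝ → ℝ, Tendsto e (𝓝[>] 0) (𝓝 0) ∧ ∀ᶠ h : ℝ in 𝓝[>] 0,
      2 * (volume D).toReal - (volume (innerPar D K h)).toReal
        - (volume (D + h • K)).toReal ≤ h * e h := by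
  obtain ⟨R, hR, hRD⟩ := exists_smul_subset_innerPar hDconv hD0 hK
  have hsmall : ∀ᶠ h : ℝ in 𝓝[>] 0, 0 < h ∧ R * h < 1 / 2 := by
    refine (show ∀ᶠ h : ℝ in 𝓝[>] 0, 0 < h from self_mem_nhdsWithin).and (nhdsWithin_le_nhds ?_)
    exact ((by fun_prop : Continuous fun h : ℝ => R * h).tendsto' 0 0 (by simp)).eventually_lt_const
      (by norm_num)
  have hin0 : ∀ {h : ℝ}, 0 < h → R * h < 1 / 2 →
      innerPar D K h ∈ 𝓝 (0 : EuclideanSpace ℝ (Fin n)) := fun {h} hh h2 =>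
    mem_of_superset ((set_smul_mem_nhds_zero_iff (by linarith : (1 - R * h) ≠ 0)).2 hD0)
      (hRD h hh.le (by linarith))
  have hsub : ∀ h : ℝ, D ⊆ D + h • K := fun h x hx => ⟨x, hx, 0, ⟨0, hK0, by simp⟩, by simp⟩
  have hout0 : ∀ h : ℝ, D + h • K ∈ 𝓝 (0 : EuclideanSpace ℝ (Fin n)) := fun h =>
    mem_of_superset hD0 (hsub h)
  set φ : Set (EuclideanSpace ℝ (Fin n)) → EuclideanSpace ℝ (Fin n) → ℝ :=
    fun S x => max 0 (1 - gauge S x) with hφ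
  set Z : ℝ → EuclideanSpace ℝ (Fin n) → ℝ := fun h x =>
    max 0 ((2 * φ D x - φ (innerPar D K h) x - φ (D + h • K) x) / h) with hZ
  have hcont : ∀ {S : Set (EuclideanSpace ℝ (Fin n))}, Convex ℝ S →
      S ∈ 𝓝 (0 : EuclideanSpace ℝ (Fin n)) → Continuous (φ S) := fun hS h0 => by
    have := continuous_gauge hS h0
    fun_prop
  have hint : ∀ {h : ℝ}, 0 < h → R * h < 1 / 2 → Integrable (fun x =>
      2 * φ D x - φ (innerPar D K h) x - φ (D + h • K) x) ∧ ∫ x,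
      2 * φ D x - φ (innerPar D K h) x - φ (D + h • K) x = (2 * (volume D).toReal -
        (volume (innerPar D K h)).toReal - (volume (D + h • K)).toReal) / (n + 1) := by
    intro h hh h2
    obtain ⟨i1, e1⟩ := integrable_max_gauge_and_integral_eq hDconv hD0 hDc.measure_ne_top
    obtain ⟨i2, e2⟩ := integrable_max_gauge_and_integral_eq (convex_innerPar hDconv K h)
      (hin0 hh h2) (isCompact_innerPar hDc ⟨0, hK0⟩ h).measure_ne_top
    obtain ⟨i3, e3⟩ := integrable_max_gauge_and_integral_eq (convex_add_smul hDconv hKconv h)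
      (hout0 h) (isCompact_add_smul hDc hK h).measure_ne_top
    refine ⟨((i1.const_mul 2).sub i2).sub i3, ?_⟩
    refine (integral_sub ((i1.const_mul 2).sub i2) i3).trans ?_
    rw [Pi.sub_def, integral_sub (i1.const_mul 2) i2, integral_const_mul, e1, e2, e3]
    ring
  have hbound : ∀ {h : ℝ}, 0 < h → R * h < 1 / 2 → ∀ x, ‖Z h x‖ ≤ D.indicator (fun _ => 2 * R) x := by
    intro h hh h2 x
    rw [Real.norm_of_nonneg (le_max_left _ _)]
    have hind : 0 ≤ D.indicator (fun _ => 2 * R) x := indicator_nonneg (fun _ _ => by positivity) x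
    refine max_le hind ?_
    rw [div_le_iff₀ hh]
    have h3 : φ D x ≤ φ (D + h • K) x := by
      have := gauge_mono (absorbent_nhds_zero hD0) (hsub h) x
      simp only [hφ]
      gcongr
    have h4 : 0 ≤ φ (innerPar D K h) x := le_max_left _ _
    rcases le_or_gt 1 (gauge D x) with hg | hg
    · have h5 : φ D x = 0 := max_eq_left (by linarith)
      nlinarith
    · have hxD : x ∈ D := by
        rw [← hDc.isClosed.closure_eq]
        exact (gauge_le_one_iff_mem_closure hDconv hD0).1 hg.le
      rw [indicator_of_mem hxD]
      have h5 : φ D x = 1 - gauge D x := max_eq_right (by linarith)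
      have h6 : 1 - gauge (innerPar D K h) x ≤ φ (innerPar D K h) x := le_max_right _ _
      have h7 : gauge (innerPar D K h) x ≤ (1 - R * h)⁻¹ * gauge D x := by
        have hpos : 0 < 1 - R * h := by linarith
        have := gauge_mono ((absorbent_nhds_zero
          ((set_smul_mem_nhds_zero_iff hpos.ne').2 hD0))) (hRD h hh.le (by linarith)) x
        rwa [gauge_smul_left_of_nonneg hpos.le, Pi.smul_apply, smul_eq_mul] at this
      have h8 : (1 - R * h)⁻¹ ≤ 1 + 2 * R * h := by
        rw [inv_le_iff_one_le_mul₀ (by linarith)]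
        nlinarith [mul_pos hR hh]
      have h9 := mul_le_mul_of_nonneg_right h8 (gauge_nonneg (s := D) x)
      nlinarith [mul_pos hR hh, gauge_nonneg (s := D) x]
  have hlim : ∀ᵐ x, Tendsto (fun h => Z h x) (𝓝[>] 0) (𝓝 0) := by
    obtain ⟨C, hC⟩ := hDconv.lipschitz_gauge hD0
    filter_upwards [hC.ae_differentiableAt] with x hx
    rw [Metric.tendsto_nhds]
    intro ε hε
    rcases eq_or_ne x 0 with rfl | hx0
    · filter_upwards with h
      simp [hZ, hφ]
      norm_num [hε]
    filter_upwards [eventually_gauge_add_gauge_le hDconv hDc hD0 hK ⟨0, hK0⟩ hx0 hx (half_pos hε),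
      self_mem_nhdsWithin] with h h1 (hh : 0 < h)
    rw [dist_zero_right, Real.norm_of_nonneg (le_max_left _ _)]
    refine (max_le (half_pos hε).le ?_).trans_lt (half_lt_self hε)
    rw [div_le_iff₀ hh]
    have h2 : 1 - gauge (innerPar D K h) x ≤ φ (innerPar D K h) x := le_max_right _ _
    have h3 : 1 - gauge (D + h • K) x ≤ φ (D + h • K) x := le_max_right _ _
    rcases le_total 1 (gauge D x) with hg | hg
    · have h4 : φ D x = 0 := max_eq_left (by linarith)
      have h5 : 0 ≤ φ (innerPar D K h) x := le_max_left _ _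
      have h6 : 0 ≤ φ (D + h • K) x := le_max_left _ _
      nlinarith
    · have h4 : φ D x = 1 - gauge D x := max_eq_right (by linarith)
      linarith
  have hZlim : Tendsto (fun h => ∫ x, Z h x) (𝓝[>] 0) (𝓝 0) := by
    have := tendsto_integral_filter_of_dominated_convergence (F := Z) (f := fun _ => 0)
      (l := 𝓝[>] 0) (μ := volume) (D.indicator fun _ => 2 * R) ?_ ?_ ?_ hlim
    · simpa using this
    · filter_upwards [hsmall] with h ⟨hh, h2⟩
      have := hcont hDconv hD0
      have := hcont (convex_innerPar hDconv K h) (hin0 hh h2)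
      have := hcont (convex_add_smul hDconv hKconv h) (hout0 h)
      exact Continuous.aestronglyMeasurable (by fun_prop)
    · filter_upwards [hsmall] with h ⟨hh, h2⟩
      exact Eventually.of_forall (hbound hh h2)
    · exact (integrable_indicator_iff hDc.measurableSet).2 (integrableOn_const hDc.measure_ne_top)
  refine ⟨fun h => (n + 1) * ∫ x, Z h x, by simpa using hZlim.const_mul ((n : ℝ) + 1), ?_⟩
  filter_upwards [hsmall] with h ⟨hh, h2⟩
  obtain ⟨hi, he⟩ := hint hh h2
  have h3 : (∫ x, 2 * φ D x - φ (innerPar D K h) x - φ (D + h • K) x) / h ≤ ∫ x, Z h x := by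
    rw [← integral_div]
    exact integral_mono (hi.div_const h) ((integrable_zero _ _ _).sup (hi.div_const h))
      fun x => le_max_right _ _
  rw [he, div_div, div_le_iff₀ (by positivity)] at h3
  linarith

theorem innerPar_zero (D : Set (EuclideanSpace ℝ (Fin n))) (hK : K.Nonempty) :
    innerPar D K 0 = D := by
  ext x
  obtain ⟨y, hy⟩ := hK
  exact ⟨fun h => by simpa using h y hy, fun h y _ => by simpa using h⟩

theorem innerPar_vadd (a b : EuclideanSpace ℝ (Fin n)) (D K : Set (EuclideanSpace ℝ (Fin n)))
    (h : ℝ) : innerPar (a +ᵥ D) (b +ᵥ K) h = (a - h • b) +ᵥ innerPar D K h := by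
  ext x
  rw [mem_vadd_set_iff_neg_vadd_mem]
  simp only [innerPar, mem_ofPred_eq, mem_vadd_set_iff_neg_vadd_mem, vadd_eq_add]
  constructor
  · intro H y hy
    convert H (b + y) (by simpa using hy) using 1
    module
  · intro H y hy
    convert H _ hy using 1
    module

theorem vadd_add_smul_vadd (a b : EuclideanSpace ℝ (Fin n)) (D K : Set (EuclideanSpace ℝ (Fin n)))
    (h : ℝ) : (a +ᵥ D) + h • (b +ᵥ K) = (a + h • b) +ᵥ (D + h • K) := by
  simp only [← singleton_vadd, vadd_eq_add, smul_add, smul_set_singleton, ← singleton_add_singleton]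
  exact add_add_add_comm _ _ _ _

theorem exists_tendsto_volume_defect_le (hDconv : Convex ℝ D) (hDc : IsCompact D)
    (hDint : (interior D).Nonempty) (hKconv : Convex ℝ K) (hK : IsCompact K) (hK0 : K.Nonempty) :
    ∃ e : ℝ → ℝ, Tendsto e (𝓝[>] 0) (𝓝 0) ∧ ∀ᶠ h : ℝ in 𝓝[>] 0,
      2 * (volume D).toReal - (volume (innerPar D K h)).toReal
        - (volume (D + h • K)).toReal ≤ h * e h := by
  obtain ⟨x₀, hx₀⟩ := hDint
  obtain ⟨y₀, hy₀⟩ := hK0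
  have := exists_tendsto_volume_defect_le_of_mem_nhds (D := -x₀ +ᵥ D) (K := -y₀ +ᵥ K)
    (hDconv.vadd _) (hDc.vadd _) ?_ (hKconv.vadd _) (hK.vadd _) ?_
  · simpa only [innerPar_vadd, vadd_add_smul_vadd, measure_vadd] using this
  · rw [mem_nhds_iff]
    refine ⟨-x₀ +ᵥ interior D, vadd_set_mono interior_subset, isOpen_interior.vadd _, ?_⟩
    simpa [mem_vadd_set_iff_neg_vadd_mem] using hx₀
  · simpa [mem_vadd_set_iff_neg_vadd_mem] using hy₀

theorem volume_pos_of_interior_nonempty (hDc : IsCompact D) (hDint : (interior D).Nonempty) :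
    0 < (volume D).toReal :=
  ENNReal.toReal_pos (Measure.measure_pos_of_nonempty_interior _ hDint).ne' hDc.measure_ne_top

/-- The first variation of the volume under inner parallel bodies is the opposite of the first
variation under outer parallel bodies. -/
theorem hasDerivWithinAt_volume_innerPar (hn : n ≠ 0) (hDconv : Convex ℝ D) (hDc : IsCompact D)
    (hDint : (interior D).Nonempty) (hKconv : Convex ℝ K) (hK : IsCompact K) (hK0 : K.Nonempty)
    {p : ℝ} (hp : HasDerivWithinAt (fun t : ℝ => (volume (D + t • K)).toReal) p (Ici 0) 0) :
    HasDerivWithinAt (fun h => (volume (innerPar D K h)).toReal) (-p) (Ici 0) 0 := by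
  obtain ⟨e, he, hle⟩ := exists_tendsto_volume_defect_le hDconv hDc hDint hKconv hK hK0
  have hn' : (n : ℝ) ≠ 0 := Nat.cast_ne_zero.2 hn
  set a := (volume D).toReal with ha
  set c : ℝ → ℝ := fun t => (volume (D + t • K)).toReal with hc
  set F : ℝ → ℝ := fun h => (volume (innerPar D K h)).toReal with hF
  have ha0 : 0 < a := volume_pos_of_interior_nonempty hDc hDint
  have hc0 : c 0 = a := by simp [hc, zero_smul_set hK0, ha]
  have hF0 : F 0 = a := by simp [hF, innerPar_zero D hK0, ha]
  set G : ℝ → ℝ := fun h => (2 * a ^ (1 / n : ℝ) - c h ^ (1 / n : ℝ)) ^ n with hG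
  have hroot : (a ^ (1 / n : ℝ)) ^ n = a := by
    rw [one_div, Real.rpow_inv_natCast_pow ha0.le hn]
  have hG0 : G 0 = a := by
    simp only [hG, hc0]
    rw [two_mul, add_sub_cancel_right, hroot]
  have hroot' : HasDerivWithinAt (fun h => 2 * a ^ (1 / n : ℝ) - c h ^ (1 / n : ℝ))
      (-(p * (1 / n) * a ^ (1 / n - 1 : ℝ))) (Ici 0) 0 := by
    have := (hp.rpow_const (p := (1 / n : ℝ)) (Or.inl (hc0.trans_ne ha0.ne'))).const_sub
      (2 * a ^ (1 / n : ℝ))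
    rwa [hc0] at this
  have hG' : HasDerivWithinAt G (-p) (Ici 0) 0 := by
    have h1 : a ^ (1 / n - 1 : ℝ) * (a ^ (1 / n : ℝ)) ^ (n - 1) = 1 := by
      rw [Real.rpow_sub_one ha0.ne', div_mul_eq_mul_div, ← pow_succ',
        Nat.sub_add_cancel (Nat.one_le_iff_ne_zero.2 hn), hroot, div_self ha0.ne']
    have h2 : 2 * a ^ (1 / n : ℝ) - a ^ (1 / n : ℝ) = a ^ (1 / n : ℝ) := by ring
    have h3 := hroot'.fun_pow n
    rw [hc0, h2] at h3
    refine h3.congr_deriv ?_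
    linear_combination (-p * (n * (1 / n))) * h1 - p * mul_one_div_cancel hn'
  have hpos : ∀ᶠ h in 𝓝[>] 0, 0 < 2 * a ^ (1 / n : ℝ) - c h ^ (1 / n : ℝ) := by
    have h1 := (hroot'.continuousWithinAt.mono Ioi_subset_Ici_self).tendsto
    refine h1.eventually_const_lt ?_
    rw [hc0]
    linarith [Real.rpow_pos_of_pos ha0 (1 / n : ℝ)]
  rw [← hasDerivWithinAt_Ioi_iff_Ici, hasDerivWithinAt_iff_tendsto_slope' self_notMem_Ioi] at hG' hp ⊢
  have hlow : Tendsto (fun h => -slope c 0 h - e h) (𝓝[>] 0) (𝓝 (-p)) := by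
    simpa using hp.neg.sub he
  refine tendsto_of_tendsto_of_tendsto_of_le_of_le' hlow hG' ?_ ?_
  · filter_upwards [hle, self_mem_nhdsWithin] with h h1 (hh : 0 < h)
    simp only [slope_def_field, hF0, hc0, sub_zero]
    rw [← neg_div, div_sub' hh.ne', div_le_div_iff_of_pos_right hh]
    linarith
  · filter_upwards [hpos, self_mem_nhdsWithin] with h h1 (hh : 0 < h)
    simp only [slope_def_field, hF0, hG0, sub_zero]
    rw [div_le_div_iff_of_pos_right hh]
    refine sub_le_sub_right ?_ a
    rcases eq_or_ne (volume (innerPar D K h)) 0 with h0 | h0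
    · simpa only [hF, h0, ENNReal.toReal_zero] using pow_nonneg h1.le n
    have hcin := isCompact_innerPar hDc hK0 h
    have hcout := isCompact_add_smul hDc hK h
    have hbm := brunn_minkowski hn (t := 1 / 2) (C := D) ⟨by norm_num, by norm_num⟩
      hcin.measurableSet hcout.measurableSet hDc.measurableSet h0 ?_
      hcin.measure_ne_top hcout.measure_ne_top hDc.measure_ne_top ?_
    · have h2 : F h ^ (1 / n : ℝ) ≤ 2 * a ^ (1 / n : ℝ) - c h ^ (1 / n : ℝ) := by
        simp only [hF, hc, ha]
        linarith
      have h3 : F h = (F h ^ (1 / n : ℝ)) ^ n := by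
        rw [one_div, Real.rpow_inv_natCast_pow ENNReal.toReal_nonneg hn]
      rw [h3]
      exact pow_le_pow_left₀ (Real.rpow_nonneg ENNReal.toReal_nonneg _) h2 n
    · obtain ⟨y, hy⟩ := hK0
      refine (Measure.measure_pos_of_nonempty_interior _ ?_).ne'
      refine hDint.add (t := h • K) ⟨h • y, y, hy, rfl⟩ |>.mono ?_
      exact subset_interior_add_left
    · rw [show (1 : ℝ) - 1 / 2 = 1 / 2 by norm_num, ← smul_add]
      rintro _ ⟨_, ⟨u, hu, _, ⟨d, hd, _, ⟨y, hy, rfl⟩, rfl⟩, rfl⟩, rfl⟩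
      convert hDconv (hu y hy) hd (by norm_num : (0 : ℝ) ≤ 1 / 2) (by norm_num : (0 : ℝ) ≤ 1 / 2)
        (by norm_num) using 1
      dsimp only
      module

end InnerParallelVariation

section RightDerivative
open Filter Topology

theorem ConcaveOn.exists_hasDerivWithinAt_Ici_of_antitoneOn {f : ℝ → ℝ} {a b l : ℝ}
    (hf : ConcaveOn ℝ (Ico a b) f) (hanti : AntitoneOn f (Ico a b)) (hl : l ∈ Ico a b) :
    ∃ d, HasDerivWithinAt f d (Ici l) l := by
  refine ⟨sSup (slope f l '' Ioo l b), ?_⟩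
  rw [← hasDerivWithinAt_Ioi_iff_Ici, hasDerivWithinAt_iff_tendsto_slope' self_notMem_Ioi]
  have hsub : ∀ {x}, x ∈ Ioo l b → x ∈ Ico a b := fun hx => ⟨hl.1.trans hx.1.le, hx.2⟩
  refine AntitoneOn.tendsto_nhdsWithin_Ioo_right (nonempty_Ioo.2 hl.2)
    ((hf.slope_anti hl).mono fun x hx => ⟨hsub hx, hx.1.ne'⟩) ⟨0, ?_⟩
  rintro _ ⟨x, hx, rfl⟩
  rw [slope_def_field]
  exact div_nonpos_of_nonpos_of_nonneg (sub_nonpos.2 (hanti hl (hsub hx) hx.1.le))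
    (sub_nonneg.2 hx.1.le)

theorem ConcaveOn.antitoneOn_of_hasDerivWithinAt_Ici {f f' : ℝ → ℝ} {a b : ℝ}
    (hf : ConcaveOn ℝ (Ico a b) f)
    (hf' : ∀ x ∈ Ico a b, HasDerivWithinAt f (f' x) (Ici x) x) : AntitoneOn f' (Ico a b) := by
  intro x hx y hy hxy
  rcases hxy.eq_or_lt with rfl | hlt
  · exact le_rfl
  refine le_trans ?_ (hf.slope_le_of_hasDerivWithinAt_Ioi hx hy hlt
    (hasDerivWithinAt_Ioi_iff_Ici.2 (hf' x hx)))
  have h := hf' y hy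
  rw [← hasDerivWithinAt_Ioi_iff_Ici, hasDerivWithinAt_iff_tendsto_slope' self_notMem_Ioi] at h
  refine le_of_tendsto h ?_
  filter_upwards [Ioo_mem_nhdsGT hy.2] with z hz
  simp only [slope_def_field]
  exact hf.slope_anti_adjacent hx ⟨hy.1.trans hz.1.le, hz.2⟩ hlt hz.1

theorem MonotoneOn.nonneg_of_hasDerivWithinAt_Ici {f : ℝ → ℝ} {a b l d : ℝ}
    (hf : MonotoneOn f (Ico a b)) (hl : l ∈ Ico a b) (hd : HasDerivWithinAt f d (Ici l) l) :
    0 ≤ d := by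
  rw [← hasDerivWithinAt_Ioi_iff_Ici, hasDerivWithinAt_iff_tendsto_slope' self_notMem_Ioi] at hd
  refine ge_of_tendsto hd ?_
  filter_upwards [Ioo_mem_nhdsGT hl.2] with z hz
  rw [slope_def_field]
  exact div_nonneg (sub_nonneg.2 (hf hl ⟨hl.1.trans hz.1.le, hz.2⟩ hz.1.le))
    (sub_nonneg.2 hz.1.le)

end RightDerivative

section InnerParallelFamily
variable {n : ℕ} {Ω K : Set (EuclideanSpace ℝ (Fin n))}

theorem innerPar_innerPar (hK : Convex ℝ K) {l h : ℝ} (hl : 0 ≤ l) (hh : 0 ≤ h) :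
    innerPar (innerPar Ω K l) K h = innerPar Ω K (l + h) := by
  ext x
  constructor
  · intro hx y hy
    have := hx y hy y hy
    rwa [add_assoc, ← add_smul, add_comm h] at this
  · intro hx y hy z hz
    have h1 : h • y + l • z ∈ (l + h) • K := by
      rw [add_comm l, hK.add_smul hh hl]
      exact ⟨_, ⟨y, hy, rfl⟩, _, ⟨z, hz, rfl⟩, rfl⟩
    obtain ⟨w, hw, hwe⟩ := h1
    rw [add_assoc, ← hwe]
    exact hx w hw

theorem exists_lt_innerPar_nonempty {l : ℝ} (hl : l ∈ Ico 0 (inrad Ω K)) :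
    ∃ m, l < m ∧ (innerPar Ω K m).Nonempty := by
  have hne : {m : ℝ | 0 ≤ m ∧ ∃ x, ∀ y ∈ K, x + m • y ∈ Ω}.Nonempty := by
    by_contra h
    rw [not_nonempty_iff_eq_empty] at h
    have := hl.1.trans_lt hl.2
    rw [inrad, h, Real.sSup_empty] at this
    exact this.false
  obtain ⟨m, ⟨-, x, hx⟩, hm⟩ := exists_lt_of_lt_csSup hne hl.2
  exact ⟨m, hm, x, hx⟩

theorem interior_innerPar_nonempty (hK : Convex ℝ K) (hKint : (interior K).Nonempty) {l : ℝ}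
    (hl : l ∈ Ico 0 (inrad Ω K)) : (interior (innerPar Ω K l)).Nonempty := by
  obtain ⟨m, hm, x, hx⟩ := exists_lt_innerPar_nonempty hl
  rw [show m = l + (m - l) by ring, ← innerPar_innerPar hK hl.1 (sub_nonneg.2 hm.le)] at hx
  obtain ⟨y, hy⟩ := hKint
  refine ⟨x + (m - l) • y, mem_interior.2 ⟨x +ᵥ (m - l) • interior K, ?_,
    (isOpen_interior.smul₀ (sub_pos.2 hm).ne').vadd x, ⟨_, ⟨y, hy, rfl⟩, rfl⟩⟩⟩
  rintro _ ⟨_, ⟨z, hz, rfl⟩, rfl⟩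
  exact hx z (interior_subset hz)

theorem smul_add_smul_subset_innerPar_add_smul (hΩ : Convex ℝ Ω) (hK : Convex ℝ K)
    {a b α β : ℝ} (hα : 0 ≤ α) (hβ : 0 ≤ β) (hαβ : α + β = 1) (s : ℝ) :
    α • (innerPar Ω K a + s • K) + β • (innerPar Ω K b + s • K) ⊆
      innerPar Ω K (α • a + β • b) + s • K := by
  rintro _ ⟨_, ⟨_, ⟨u, hu, _, ⟨y, hy, rfl⟩, rfl⟩, rfl⟩,
    _, ⟨_, ⟨v, hv, _, ⟨z, hz, rfl⟩, rfl⟩, rfl⟩, rfl⟩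
  refine ⟨α • u + β • v, fun w hw => ?_, s • (α • y + β • z), ⟨_, hK hy hz hα hβ hαβ, rfl⟩, ?_⟩
  · convert hΩ (hu w hw) (hv w hw) hα hβ hαβ using 1
    rw [smul_eq_mul, smul_eq_mul]
    module
  · dsimp only
    module

theorem concaveOn_volume_innerPar_add_smul (hn : n ≠ 0) (hΩc : IsCompact Ω) (hΩ : Convex ℝ Ω)
    (hKc : IsCompact K) (hK : Convex ℝ K) (hKint : (interior K).Nonempty) (s : ℝ) :
    ConcaveOn ℝ (Ico 0 (inrad Ω K))
      fun l => (volume (innerPar Ω K l + s • K)).toReal ^ (1 / n : ℝ) := by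
  have hK0 : K.Nonempty := hKint.mono interior_subset
  have hcpt : ∀ l, IsCompact (innerPar Ω K l + s • K) := fun l =>
    isCompact_add_smul (isCompact_innerPar hΩc hK0 l) hKc s
  have hpos : ∀ l ∈ Ico 0 (inrad Ω K), volume (innerPar Ω K l + s • K) ≠ 0 := fun l hl =>
    (Measure.measure_pos_of_nonempty_interior _
      (((interior_innerPar_nonempty hK hKint hl).add hK0.smul_set).mono
        subset_interior_add_left)).ne'
  refine concaveOn_iff_forall_pos.2 ⟨convex_Ico _ _, fun a ha b hb α β hα hβ hαβ => ?_⟩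
  obtain rfl : α = 1 - β := by linarith
  exact brunn_minkowski hn ⟨hβ, by linarith⟩ (hcpt a).measurableSet (hcpt b).measurableSet
    (hcpt _).measurableSet (hpos a ha) (hpos b hb) (hcpt a).measure_ne_top (hcpt b).measure_ne_top
    (hcpt _).measure_ne_top (smul_add_smul_subset_innerPar_add_smul hΩ hK hα.le hβ.le hαβ s)

theorem antitoneOn_volume_innerPar_add_smul (hΩc : IsCompact Ω) (hKc : IsCompact K)
    (hK : Convex ℝ K) (hK0 : K.Nonempty) (s : ℝ) :
    AntitoneOn (fun l => (volume (innerPar Ω K l + s • K)).toReal) (Ici 0) := by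
  intro a ha b _ hab
  obtain ⟨y, hy⟩ := hK0
  refine ENNReal.toReal_mono
    (isCompact_add_smul (isCompact_innerPar hΩc ⟨y, hy⟩ a) hKc s).measure_ne_top ?_
  rw [← measure_vadd volume ((b - a) • y)]
  refine measure_mono ?_
  rintro _ ⟨_, ⟨u, hu, z, hz, rfl⟩, rfl⟩
  rw [show b = a + (b - a) by ring, ← innerPar_innerPar hK ha (sub_nonneg.2 hab)] at hu
  exact ⟨_, hu y hy, z, hz, by simp only [vadd_eq_add]; abel⟩

theorem exists_hasDerivWithinAt_volume_innerPar_add_smul (hn : n ≠ 0) (hΩc : IsCompact Ω)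
    (hΩ : Convex ℝ Ω) (hKc : IsCompact K) (hK : Convex ℝ K) (hKint : (interior K).Nonempty)
    (s : ℝ) {l : ℝ} (hl : l ∈ Ico 0 (inrad Ω K)) :
    ∃ d, HasDerivWithinAt (fun t => (volume (innerPar Ω K t + s • K)).toReal) d (Ici l) l := by
  have hanti := (antitoneOn_volume_innerPar_add_smul hΩc hKc hK (hKint.mono interior_subset) s).mono
    (fun _ h => h.1 : Ico 0 (inrad Ω K) ⊆ Ici 0)
  have hconc := concaveOn_volume_innerPar_add_smul hn hΩc hΩ hKc hK hKint s
  obtain ⟨d, hd⟩ := hconc.exists_hasDerivWithinAt_Ici_of_antitoneOn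
    (fun a ha b hb hab => Real.rpow_le_rpow ENNReal.toReal_nonneg (hanti ha hb hab)
      (by positivity)) hl
  refine ⟨_, (hd.fun_pow n).congr_of_mem (fun t _ => ?_) self_mem_Ici⟩
  rw [one_div, Real.rpow_inv_natCast_pow ENNReal.toReal_nonneg hn]

theorem exists_hasDerivWithinAt_aniPer_innerPar (hn : n ≠ 0) (hΩc : IsCompact Ω)
    (hΩ : Convex ℝ Ω) (hKc : IsCompact K) (hK : Convex ℝ K) (hKint : (interior K).Nonempty)
    {l : ℝ} (hl : l ∈ Ico 0 (inrad Ω K)) :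
    ∃ d, HasDerivWithinAt (fun t => aniPer (innerPar Ω K t) K) d (Ici l) l := by
  have hK0 : K.Nonempty := hKint.mono interior_subset
  choose d hd using fun i : ℕ =>
    exists_hasDerivWithinAt_volume_innerPar_add_smul hn hΩc hΩ hKc hK hKint i hl
  have heq : ∀ t ∈ Ico 0 (inrad Ω K), aniPer (innerPar Ω K t) K = _ := fun t ht =>
    aniPer_eq_sum (isCompact_innerPar hΩc hK0 t)
      ((interior_innerPar_nonempty hK hKint ht).mono interior_subset) (convex_innerPar hΩ K t)
      hKc hK0 hK
  refine ⟨_, (HasDerivWithinAt.fun_sum (u := Finset.range (n + 1)) fun i _ =>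
    (hd i).const_mul ((steinerBasis n i).derivative.eval 0)).congr_of_eventuallyEq ?_ (heq l hl)⟩
  filter_upwards [Ico_mem_nhdsGE hl.2] with t ht
  exact heq t ⟨hl.1.trans ht.1, ht.2⟩

theorem hasDerivWithinAt_volume_innerPar_Ici (hn : n ≠ 0) (hΩc : IsCompact Ω)
    (hΩ : Convex ℝ Ω) (hKc : IsCompact K) (hK : Convex ℝ K) (hKint : (interior K).Nonempty)
    {l : ℝ} (hl : l ∈ Ico 0 (inrad Ω K)) :
    HasDerivWithinAt (fun t => (volume (innerPar Ω K t)).toReal) (-aniPer (innerPar Ω K l) K)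
      (Ici l) l := by
  have hK0 : K.Nonempty := hKint.mono interior_subset
  have hint := interior_innerPar_nonempty hK hKint hl
  have hcpt := isCompact_innerPar hΩc hK0 l
  have hconv := convex_innerPar hΩ K l
  have hp := hasDerivWithinAt_volume_add_smul hcpt (hint.mono interior_subset) hconv hKc hK0 hK
  rw [← aniPer_eq_sum hcpt (hint.mono interior_subset) hconv hKc hK0 hK] at hp
  have h := hasDerivWithinAt_volume_innerPar hn hconv hcpt hint hK hKc hK0 hp
  rw [← sub_self l] at h
  have h2 := h.comp (h := fun t => t - l) (s := Ici l) l ((hasDerivWithinAt_id l _).sub_const l)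
    fun t ht => by simpa using ht
  rw [mul_one] at h2
  refine h2.congr_of_mem (fun t ht => ?_) self_mem_Ici
  rw [Function.comp_apply, innerPar_innerPar hK hl.1 (sub_nonneg.2 ht), add_sub_cancel]

end InnerParallelFamily

/-- the right derivative `p′₊(λ)` of `p(λ) = Per_K(Ω∼λK)` exists on
`[0, r)` and `ξ(λ) = p(λ)² + (n/(n-1))·v(λ)·p′₊(λ) ≥ 0`. -/
theorem stmt19 {n : ℕ} (hn : 2 ≤ n) (Ω K : Set (EuclideanSpace ℝ (Fin n)))
    (hΩc : IsCompact Ω) (hΩconv : Convex ℝ Ω) (hΩint : (interior Ω).Nonempty)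
    (hKc : IsCompact K) (hKconv : Convex ℝ K) (hKint : (interior K).Nonempty) :
    ∀ l ∈ Set.Ico 0 (inrad Ω K), ∃ d : ℝ,
      HasDerivWithinAt (fun t => aniPer (innerPar Ω K t) K) d (Set.Ici l) l ∧
        0 ≤ aniPer (innerPar Ω K l) K ^ 2 +
          ((n : ℝ) / ((n : ℝ) - 1)) * (volume (innerPar Ω K l)).toReal * d := by
  have hn0 : n ≠ 0 := by omega
  have hnR : (0 : ℝ) < n := by positivity
  have hn1 : (0 : ℝ) < n - 1 := by
    have : (2 : ℝ) ≤ n := by exact_mod_cast hn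
    linarith
  have hK0 : K.Nonempty := hKint.mono interior_subset
  intro l hl
  obtain ⟨d, hd⟩ := exists_hasDerivWithinAt_aniPer_innerPar hn0 hΩc hΩconv hKc hKconv hKint hl
  refine ⟨d, hd, ?_⟩
  set p : ℝ → ℝ := fun t => aniPer (innerPar Ω K t) K with hp
  set v : ℝ → ℝ := fun t => (volume (innerPar Ω K t)).toReal with hv
  have hv' : ∀ t ∈ Ico 0 (inrad Ω K), HasDerivWithinAt v (-p t) (Ici t) t := fun t ht =>
    hasDerivWithinAt_volume_innerPar_Ici hn0 hΩc hΩconv hKc hKconv hKint ht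
  have hvpos : ∀ t ∈ Ico 0 (inrad Ω K), 0 < v t := fun t ht =>
    volume_pos_of_interior_nonempty (isCompact_innerPar hΩc hK0 t)
      (interior_innerPar_nonempty hKconv hKint ht)
  have hconc : ConcaveOn ℝ (Ico 0 (inrad Ω K)) fun t => v t ^ (1 / n : ℝ) := by
    simpa [zero_smul_set hK0] using
      concaveOn_volume_innerPar_add_smul hn0 hΩc hΩconv hKc hKconv hKint 0
  have hanti := hconc.antitoneOn_of_hasDerivWithinAt_Ici
    fun t ht => (hv' t ht).rpow_const (Or.inl (hvpos t ht).ne')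
  have hmono : MonotoneOn (fun t => p t * v t ^ (1 / n - 1 : ℝ)) (Ico 0 (inrad Ω K)) := by
    intro a ha b hb hab
    have h := hanti ha hb hab
    refine le_of_mul_le_mul_left ?_ (one_div_pos.2 hnR)
    dsimp only at h ⊢
    linarith
  have hvl := hvpos l hl
  have h := hmono.nonneg_of_hasDerivWithinAt_Ici hl
    (hd.mul ((hv' l hl).rpow_const (p := (1 / n - 1 : ℝ)) (Or.inl hvl.ne')))
  rw [Real.rpow_sub_one hvl.ne' (1 / n - 1 : ℝ)] at h
  have h2 : 0 ≤ (d * v l + (1 - 1 / n) * p l ^ 2) * (v l ^ (1 / n - 1 : ℝ) / v l) := by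
    refine h.trans_eq ?_
    field_simp
    ring
  have h3 := nonneg_of_mul_nonneg_left h2 (div_pos (Real.rpow_pos_of_pos hvl _) hvl)
  have h4 : p l ^ 2 + n / (n - 1) * v l * d =
      n / (n - 1) * (d * v l + (1 - 1 / n) * p l ^ 2) := by
    field_simp
    ring
  exact h4 ▸ mul_nonneg (by positivity) h3
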